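/- arXiv:2207.11832 — 4 statements merged into one kernel-verified Lean document; each statement's English description precedes it below -/
import Mathlib

section
/- There exist an absolute constant ε > 0 and a threshold C such that for every real c₀ ≥ C there are infinitely many positive integers n with the following property: there exists a simple graph G on n vertices such that every spanning subgraph H of G with at most c₀·n edges contains a pair of vertices u, v with dist_G(u,v) finite and dist_H(u,v) ≥ dist_G(u,v) + ε·n^{1/7}·c₀^{−80}. -/
/-- Parameters of the obstacle product: `m` inner slopes, inner paths of `D` edges, outer edges
subdivided by `mids` vertices, outer paths of `ell` edges, and additive error `e`. -/
structure ObstacleParams where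
  m : ℕ
  Y : ℕ
  D : ℕ
  mids : ℕ
  ell : ℕ
  e : ℕ
  m_pos : 0 < m
  D_pos : 0 < D
  mids_pos : 0 < mids
  slope_bound : (mids + 1 + D) * (4 * m ^ 2) ≤ (mids + 1) * Y
  gap_bound : 2 * (Y + 4 * m ^ 2) * e ≤ mids + 1

namespace ObstacleParams

variable (P : ObstacleParams)

/-- Height of the port region of an inner graph; inner steps are `(i, 2 * Q - i ^ 2)`. -/
def Q : ℕ := P.Y + 4 * P.m ^ 2

/-- Number of ports per inner slope. -/
def R : ℕ := P.D * P.m * P.Q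

/-- Outer steps are `(s, Z - s ^ 2)`. -/
def Z : ℕ := P.Y * P.R ^ 2

/-- Length of a subdivided outer edge. -/
def L : ℕ := P.mids + 1

/-- Length of a canonical path between consecutive outer nodes. -/
def T : ℕ := P.L + P.D

/-- The index of the outer step attached to port `r` of slope `i`. -/
def idx (i r : ℕ) : ℕ := 2 * i * P.R + r

/-- Half the width of the outer box. -/
def A : ℕ := P.ell * (2 * P.m * P.R)

/-- Half the height of the outer box. -/
def B : ℕ := P.ell * P.Z

/-- Vertices of the inner graphs: an outer node together with an inner position. -/
abbrev Core : Type :=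
  Fin (2 * P.A) × Fin (2 * P.B) × Fin (2 * P.D * P.m) × Fin (P.Q + 2 * P.Q * P.D)

/-- Subdivision vertices: an outer node, an outgoing step and a position on the edge. -/
abbrev Mid : Type :=
  (Fin (2 * P.A) × Fin (2 * P.B)) × (Fin P.m × Fin P.R) × Fin P.mids

/-- First coordinate of the `k`-th vertex of the inner path of port `r` and slope `i`. -/
def pathX (i r k : ℕ) : ℤ := ((r / P.Q : ℕ) : ℤ) + k * i

/-- Second coordinate of the `k`-th vertex of the inner path of port `r` and slope `i`. -/
def pathY (i r k : ℕ) : ℤ := ((r % P.Q : ℕ) : ℤ) + k * (2 * P.Q - (i : ℤ) ^ 2)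

/-- Second coordinate of the outer step of index `s`. -/
def rise (s : ℕ) : ℤ := P.Z - (s : ℤ) ^ 2

/-- The core vertex `y` has the given coordinates. -/
def At (y : P.Core) (z₁ z₂ x₁ x₂ : ℤ) : Prop :=
  (y.1 : ℤ) = z₁ ∧ (y.2.1 : ℤ) = z₂ ∧ (y.2.2.1 : ℤ) = x₁ ∧ (y.2.2.2 : ℤ) = x₂

/-- Oriented edges of the obstacle product. -/
def Rel : P.Core ⊕ P.Mid → P.Core ⊕ P.Mid → Prop
  | .inl y, .inl y' => ∃ i < P.m,
      P.At y' y.1 y.2.1 ((y.2.2.1 : ℤ) + i) ((y.2.2.2 : ℤ) + (2 * P.Q - (i : ℤ) ^ 2))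
  | .inl y, .inr w => (w.2.2 : ℕ) = 0 ∧
      P.At y w.1.1 w.1.2 (P.pathX w.2.1.1 w.2.1.2 P.D) (P.pathY w.2.1.1 w.2.1.2 P.D)
  | .inr w, .inl y => (w.2.2 : ℕ) + 1 = P.mids ∧
      P.At y ((w.1.1 : ℤ) + P.idx w.2.1.1 w.2.1.2) ((w.1.2 : ℤ) + P.rise (P.idx w.2.1.1 w.2.1.2))
        (P.pathX w.2.1.1 w.2.1.2 0) (P.pathY w.2.1.1 w.2.1.2 0)
  | .inr w, .inr w' => w'.1 = w.1 ∧ w'.2.1 = w.2.1 ∧ (w'.2.2 : ℕ) = w.2.2 + 1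

/-- The obstacle product graph. -/
def graph : SimpleGraph (P.Core ⊕ P.Mid) := SimpleGraph.fromRel P.Rel

/-! ### Arithmetic of the parameters -/

theorem L_pos : 0 < P.L := Nat.succ_pos _

theorem T_pos : 0 < P.T := Nat.add_pos_left P.L_pos _

theorem four_m_sq_le_Y : 4 * P.m ^ 2 ≤ P.Y := by
  have h := P.slope_bound
  have : (P.mids + 1) * (4 * P.m ^ 2) ≤ (P.mids + 1) * P.Y :=
    le_trans (Nat.mul_le_mul_right _ (Nat.le_add_right _ _)) h
  exact Nat.le_of_mul_le_mul_left this (Nat.succ_pos _)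

theorem m_sq_pos : 0 < P.m ^ 2 := pow_pos P.m_pos 2

theorem Y_pos : 0 < P.Y := by
  have := P.four_m_sq_le_Y
  have := P.m_sq_pos
  omega

theorem Q_pos : 0 < P.Q := Nat.add_pos_left P.Y_pos _

theorem R_pos : 0 < P.R := Nat.mul_pos (Nat.mul_pos P.D_pos P.m_pos) P.Q_pos

theorem Z_pos : 0 < P.Z := Nat.mul_pos P.Y_pos (pow_pos P.R_pos 2)

variable {P}

theorem sq_le_Q {i : ℕ} (hi : i < P.m) : i ^ 2 ≤ P.Q := by
  have : i ^ 2 ≤ P.m ^ 2 := Nat.pow_le_pow_left hi.le 2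
  unfold Q
  omega

theorem idx_le {i r : ℕ} (hi : i < P.m) (hr : r < P.R) : P.idx i r ≤ 2 * P.m * P.R := by
  unfold idx
  nlinarith

theorem idx_sq_le {i r : ℕ} (hi : i < P.m) (hr : r < P.R) :
    P.idx i r ^ 2 ≤ 4 * P.m ^ 2 * P.R ^ 2 :=
  calc P.idx i r ^ 2 ≤ (2 * P.m * P.R) ^ 2 := Nat.pow_le_pow_left (idx_le hi hr) 2
    _ = _ := by ring

theorem idx_sq_le_Z {i r : ℕ} (hi : i < P.m) (hr : r < P.R) : P.idx i r ^ 2 ≤ P.Z :=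
  (idx_sq_le hi hr).trans (Nat.mul_le_mul_right _ P.four_m_sq_le_Y)

theorem e_le_L : P.e ≤ P.L := by
  have h := P.gap_bound
  have : 1 ≤ 2 * (P.Y + 4 * P.m ^ 2) := by have := P.Y_pos; omega
  unfold L
  nlinarith

/-- The difference of two outer indices dominates the difference of their slopes. -/
theorem idx_sub_sq_ge {i j r r' : ℕ} (hr : r < P.R) (hr' : r' < P.R) :
    (P.R : ℝ) ^ 2 * ((i : ℝ) - j) ^ 2 ≤ ((P.idx i r : ℝ) - P.idx j r') ^ 2 := by
  have hr₁ : (r : ℝ) ≤ P.R := by exact_mod_cast hr.le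
  have hr₂ : (r' : ℝ) ≤ P.R := by exact_mod_cast hr'.le
  have h₁ : (0 : ℝ) ≤ r := by positivity
  have h₂ : (0 : ℝ) ≤ r' := by positivity
  have hd : (P.idx i r : ℝ) - P.idx j r' = 2 * P.R * (i - j) + (r - r') := by
    unfold idx; push_cast; ring
  rw [hd, ← mul_pow]
  apply sq_le_sq.2
  rcases lt_trichotomy i j with h | h | h
  · have h' : (i : ℝ) + 1 ≤ j := by exact_mod_cast h
    rw [abs_of_nonpos (by nlinarith), abs_of_nonpos (by nlinarith)]
    nlinarith
  · subst h; simp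
  · have h' : (j : ℝ) + 1 ≤ i := by exact_mod_cast h
    rw [abs_of_nonneg (by nlinarith), abs_of_nonneg (by nlinarith)]
    nlinarith

theorem idx_sub_sq_le {i j r r' : ℕ} (hi : i < P.m) (hj : j < P.m) (hr : r < P.R)
    (hr' : r' < P.R) :
    ((P.idx i r : ℝ) - P.idx j r') ^ 2 ≤ 4 * P.m ^ 2 * P.R ^ 2 := by
  have h₁ : (P.idx i r : ℝ) ≤ 2 * P.m * P.R := by exact_mod_cast idx_le hi hr
  have h₂ : (P.idx j r' : ℝ) ≤ 2 * P.m * P.R := by exact_mod_cast idx_le hj hr'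
  have h₃ : (0 : ℝ) ≤ P.idx i r := by positivity
  have h₄ : (0 : ℝ) ≤ P.idx j r' := by positivity
  have : (4 * P.m ^ 2 * P.R ^ 2 : ℝ) = (2 * P.m * P.R) ^ 2 := by ring
  rw [this]
  apply sq_le_sq'
  · linarith
  · linarith

variable (P)

/-! ### Linear potentials -/

/-- Outer potential normalised to be `1` on the step of index `s`. -/
noncomputable def phi (s : ℕ) (z₁ z₂ : ℤ) : ℝ := (z₂ + 2 * s * z₁) / (P.Z + (s : ℝ) ^ 2)

/-- Inner potential normalised to be `1` on the step of slope `j`. -/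
noncomputable def beta (j : ℕ) (x₁ x₂ : ℤ) : ℝ := (x₂ + 2 * j * x₁) / (2 * P.Q + (j : ℝ) ^ 2)

theorem phi_add (s : ℕ) (z₁ z₂ w₁ w₂ : ℤ) :
    P.phi s (z₁ + w₁) (z₂ + w₂) = P.phi s z₁ z₂ + P.phi s w₁ w₂ := by
  unfold phi; push_cast; ring

theorem beta_add (j : ℕ) (x₁ x₂ w₁ w₂ : ℤ) :
    P.beta j (x₁ + w₁) (x₂ + w₂) = P.beta j x₁ x₂ + P.beta j w₁ w₂ := by
  unfold beta; push_cast; ring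

theorem phi_den_pos (s : ℕ) : (0 : ℝ) < P.Z + (s : ℝ) ^ 2 := by
  have : (0 : ℝ) < P.Z := by exact_mod_cast P.Z_pos
  positivity

theorem beta_den_pos (j : ℕ) : (0 : ℝ) < 2 * P.Q + (j : ℝ) ^ 2 := by
  have : (0 : ℝ) < P.Q := by exact_mod_cast P.Q_pos
  positivity

theorem phi_step (s s' : ℕ) :
    P.phi s s' (P.rise s') = 1 - ((s' : ℝ) - s) ^ 2 / (P.Z + (s : ℝ) ^ 2) := by
  have := P.phi_den_pos s
  unfold phi rise
  push_cast
  field_simp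
  ring

theorem beta_step (i j : ℕ) :
    P.beta j i (2 * P.Q - (i : ℤ) ^ 2) = 1 - ((i : ℝ) - j) ^ 2 / (2 * P.Q + (j : ℝ) ^ 2) := by
  have := P.beta_den_pos j
  unfold beta
  push_cast
  field_simp
  ring

theorem phi_step_le_one (s s' : ℕ) : P.phi s s' (P.rise s') ≤ 1 := by
  rw [phi_step]
  have := P.phi_den_pos s
  have : 0 ≤ ((s' : ℝ) - s) ^ 2 / (P.Z + (s : ℝ) ^ 2) := by positivity
  linarith

theorem phi_step_lt_one {s s' : ℕ} (h : s' ≠ s) : P.phi s s' (P.rise s') < 1 := by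
  rw [phi_step]
  have := P.phi_den_pos s
  have h' : (s' : ℝ) - s ≠ 0 := sub_ne_zero.2 (by exact_mod_cast h)
  have : 0 < ((s' : ℝ) - s) ^ 2 / (P.Z + (s : ℝ) ^ 2) := by positivity
  linarith

theorem beta_step_le_one (i j : ℕ) : P.beta j i (2 * P.Q - (i : ℤ) ^ 2) ≤ 1 := by
  rw [beta_step]
  have := P.beta_den_pos j
  have : 0 ≤ ((i : ℝ) - j) ^ 2 / (2 * P.Q + (j : ℝ) ^ 2) := by positivity
  linarith

theorem beta_step_lt_one {i j : ℕ} (h : i ≠ j) : P.beta j i (2 * P.Q - (i : ℤ) ^ 2) < 1 := by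
  rw [beta_step]
  have := P.beta_den_pos j
  have h' : (i : ℝ) - j ≠ 0 := sub_ne_zero.2 (by exact_mod_cast h)
  have : 0 < ((i : ℝ) - j) ^ 2 / (2 * P.Q + (j : ℝ) ^ 2) := by positivity
  linarith

theorem beta_step_pos {i : ℕ} (j : ℕ) (hi : i < P.m) :
    0 < P.beta j i (2 * P.Q - (i : ℤ) ^ 2) := by
  have h : ((i ^ 2 : ℕ) : ℝ) ≤ P.Q := by exact_mod_cast sq_le_Q hi
  have hQ : (0 : ℝ) < P.Q := by exact_mod_cast P.Q_pos
  unfold beta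
  apply div_pos _ (P.beta_den_pos j)
  push_cast at h ⊢
  have : (0 : ℝ) ≤ 2 * j * i := by positivity
  linarith

theorem beta_path (i j r k : ℕ) :
    P.beta j (P.pathX i r k) (P.pathY i r k) =
      P.beta j (P.pathX i r 0) (P.pathY i r 0) + k * P.beta j i (2 * P.Q - (i : ℤ) ^ 2) := by
  unfold beta pathX pathY
  push_cast
  ring

/-- Forward outer edges of a wrong slope leave slack at least `e`. -/
theorem forward_slack {i j r r' : ℕ} (hj : j < P.m) (hr : r < P.R)
    (hr' : r' < P.R) (hij : i ≠ j) :
    P.T * P.phi (P.idx j r') (P.idx i r) (P.rise (P.idx i r)) + P.e ≤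
      P.L + P.D * P.beta j i (2 * P.Q - (i : ℤ) ^ 2) := by
  rw [phi_step, beta_step]
  have hQ : (0 : ℝ) < P.Q := by exact_mod_cast P.Q_pos
  have hT : (P.T : ℝ) = P.L + P.D := by unfold T; push_cast; ring
  have hgap : 2 * (P.Q : ℝ) * P.e ≤ P.L := by exact_mod_cast P.gap_bound
  have hd : 1 ≤ ((i : ℝ) - j) ^ 2 := by
    have h1 : (1 : ℤ) ≤ ((i : ℤ) - j) ^ 2 := by
      have : ((i : ℤ) - j) ≠ 0 := sub_ne_zero.2 (by exact_mod_cast hij)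
      have := pow_pos (abs_pos.2 this) 2
      rw [sq_abs] at this
      omega
    exact_mod_cast h1
  have hden : (P.Z : ℝ) + (P.idx j r' : ℝ) ^ 2 ≤ P.Q * P.R ^ 2 := by
    have h := idx_sq_le hj hr'
    have : P.Z + P.idx j r' ^ 2 ≤ P.Q * P.R ^ 2 := by
      unfold Q
      calc P.Z + P.idx j r' ^ 2 ≤ P.Z + 4 * P.m ^ 2 * P.R ^ 2 := by omega
        _ = _ := by unfold Z; ring
    exact_mod_cast this
  have h₁ : ((i : ℝ) - j) ^ 2 / P.Q ≤
      ((P.idx i r : ℝ) - P.idx j r') ^ 2 / (P.Z + (P.idx j r' : ℝ) ^ 2) := by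
    rw [div_le_div_iff₀ hQ (P.phi_den_pos _)]
    have := idx_sub_sq_ge (i := i) (j := j) hr hr'
    nlinarith [sq_nonneg ((i : ℝ) - j)]
  have h₂ : ((i : ℝ) - j) ^ 2 / (2 * P.Q + (j : ℝ) ^ 2) ≤ ((i : ℝ) - j) ^ 2 / (2 * P.Q) := by
    gcongr
    nlinarith [sq_nonneg (j : ℝ)]
  have h₃ : (P.e : ℝ) ≤ P.L * (((i : ℝ) - j) ^ 2 / (2 * P.Q)) := by
    rw [mul_div_assoc', le_div_iff₀ (by positivity)]
    nlinarith [(Nat.cast_nonneg P.L : (0 : ℝ) ≤ P.L)]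
  have h₄ : ((i : ℝ) - j) ^ 2 / P.Q = 2 * (((i : ℝ) - j) ^ 2 / (2 * P.Q)) := by
    field_simp
  set a := ((i : ℝ) - j) ^ 2 / (2 * P.Q)
  have ha : 0 ≤ a := by positivity
  rw [h₄] at h₁
  rw [hT]
  have hL : (0 : ℝ) ≤ P.L := by positivity
  have hD : (0 : ℝ) ≤ P.D := by positivity
  have h₅ := mul_le_mul_of_nonneg_left h₁ (add_nonneg hL hD)
  have h₆ := mul_le_mul_of_nonneg_left h₂ hD
  nlinarith [mul_nonneg hL ha, mul_nonneg hD ha]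

/-- Backward outer edges leave slack at least `e`. -/
theorem backward_slack {i j r r' : ℕ} (hi : i < P.m) (hj : j < P.m) (hr : r < P.R)
    (hr' : r' < P.R) :
    P.D * P.beta j i (2 * P.Q - (i : ℤ) ^ 2) + P.e ≤
      P.L + P.T * P.phi (P.idx j r') (P.idx i r) (P.rise (P.idx i r)) := by
  have hβ := P.beta_step_le_one i j
  rw [phi_step]
  have hT : (P.T : ℝ) = P.L + P.D := by unfold T; push_cast; ring
  have hT₀ : (0 : ℝ) < P.T := by exact_mod_cast P.T_pos
  have hD : (0 : ℝ) ≤ P.D := by positivity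
  have hL : (0 : ℝ) < P.L := by exact_mod_cast P.L_pos
  have he : (P.e : ℝ) ≤ P.L := by exact_mod_cast e_le_L
  have hR : (0 : ℝ) < P.R := by exact_mod_cast P.R_pos
  have hs : (P.T : ℝ) * (4 * P.m ^ 2) ≤ P.L * P.Y := by exact_mod_cast P.slope_bound
  have h₁ : (P.T : ℝ) * (((P.idx i r : ℝ) - P.idx j r') ^ 2 / (P.Z + (P.idx j r' : ℝ) ^ 2)) ≤
      P.L := by
    rw [mul_div_assoc', div_le_iff₀ (P.phi_den_pos _)]
    calc (P.T : ℝ) * ((P.idx i r : ℝ) - P.idx j r') ^ 2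
        ≤ P.T * (4 * (P.m : ℝ) ^ 2 * (P.R : ℝ) ^ 2) := by
          gcongr; exact idx_sub_sq_le hi hj hr hr'
      _ = P.T * (4 * (P.m : ℝ) ^ 2) * (P.R : ℝ) ^ 2 := by ring
      _ ≤ P.L * P.Y * (P.R : ℝ) ^ 2 := by gcongr
      _ = P.L * (P.Z : ℝ) := by unfold Z; push_cast; ring
      _ ≤ P.L * (P.Z + (P.idx j r' : ℝ) ^ 2) := by gcongr; nlinarith [sq_nonneg (P.idx j r' : ℝ)]
  nlinarith [mul_le_mul_of_nonneg_left hβ hD]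

/-! ### Distance certificates -/

/-- The number of the first `a` nodes of a canonical path at which the inner path is broken. -/
noncomputable def broken (Pre : ℕ → ℕ → Prop) (a : ℕ) : ℕ := by
  classical exact ((Finset.range a).filter fun i => ¬ Pre i P.D).card

/-- Inner potential measured from the entry port `r` of slope `j`. -/
noncomputable def gamma (j r : ℕ) (x₁ x₂ : ℤ) : ℝ :=
  P.beta j x₁ x₂ - P.beta j (P.pathX j r 0) (P.pathY j r 0)

/-- A lower-bound certificate for the length `t` of a walk from the start `s` of the canonical path
with step `(j, r)` to the core vertex with the given coordinates. The walk has already lost `e`, or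
it has left the outer path for good, or it is on the outer path, having paid for every broken inner
path. Here `Pre a k` says that the first `k` edges of the inner path at the `a`-th node survive. -/
def Cert (j r : ℕ) (s₁ s₂ : ℤ) (Pre : ℕ → ℕ → Prop) (z₁ z₂ x₁ x₂ : ℤ) (t : ℝ) : Prop :=
  P.T * P.phi (P.idx j r) (z₁ - s₁) (z₂ - s₂) + P.gamma j r x₁ x₂ + P.e ≤ t ∨
  (∃ a : ℤ, P.phi (P.idx j r) (z₁ - s₁) (z₂ - s₂) < a ∧ P.T * a + P.gamma j r x₁ x₂ ≤ t) ∨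
  ∃ a : ℕ, z₁ = s₁ + a * P.idx j r ∧ z₂ = s₂ + a * P.rise (P.idx j r) ∧
    ∃ k : ℤ, (P.T * a + P.broken Pre a + k : ℝ) ≤ t ∧
      (P.gamma j r x₁ x₂ < k ∨
        ∃ n : ℕ, k = n ∧ x₁ = P.pathX j r n ∧ x₂ = P.pathY j r n ∧ Pre a n)

section Cert

variable {P}
variable {j r : ℕ} {s₁ s₂ : ℤ} {Pre : ℕ → ℕ → Prop} {z₁ z₂ x₁ x₂ : ℤ} {t t' : ℝ}

theorem Cert.mono (h : P.Cert j r s₁ s₂ Pre z₁ z₂ x₁ x₂ t) (ht : t ≤ t') :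
    P.Cert j r s₁ s₂ Pre z₁ z₂ x₁ x₂ t' := by
  rcases h with h | ⟨a, h₁, h₂⟩ | ⟨a, h₁, h₂, k, h₃, h₄⟩
  · exact .inl (h.trans ht)
  · exact .inr (.inl ⟨a, h₁, h₂.trans ht⟩)
  · exact .inr (.inr ⟨a, h₁, h₂, k, h₃.trans ht, h₄⟩)

theorem gamma_add (j r : ℕ) (x₁ x₂ w₁ w₂ : ℤ) :
    P.gamma j r (x₁ + w₁) (x₂ + w₂) = P.gamma j r x₁ x₂ + P.beta j w₁ w₂ := by
  unfold gamma; rw [beta_add]; ring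

theorem beta_step_self (j : ℕ) : P.beta j j (2 * P.Q - (j : ℤ) ^ 2) = 1 := by
  rw [beta_step]; simp

theorem gamma_path (j r n : ℕ) : P.gamma j r (P.pathX j r n) (P.pathY j r n) = n := by
  unfold gamma; rw [beta_path, beta_step_self]; ring

theorem phi_canonical (j r a : ℕ) :
    P.phi (P.idx j r) (a * P.idx j r) (a * P.rise (P.idx j r)) = a := by
  have h := P.phi_step (P.idx j r) (P.idx j r)
  have h' : P.phi (P.idx j r) (a * P.idx j r) (a * P.rise (P.idx j r)) =
      a * P.phi (P.idx j r) (P.idx j r) (P.rise (P.idx j r)) := by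
    unfold phi; push_cast; ring
  rw [h', h]; simp

theorem Cert.potential_le (h : P.Cert j r s₁ s₂ Pre z₁ z₂ x₁ x₂ t) :
    P.T * P.phi (P.idx j r) (z₁ - s₁) (z₂ - s₂) + P.gamma j r x₁ x₂ ≤ t := by
  have he : (0 : ℝ) ≤ P.e := by positivity
  have hT : (0 : ℝ) < P.T := by exact_mod_cast P.T_pos
  rcases h with h | ⟨a, h₁, h₂⟩ | ⟨a, rfl, rfl, k, h₃, h₄⟩
  · linarith
  · nlinarith
  · have hk : P.gamma j r x₁ x₂ ≤ k := by
      rcases h₄ with h | ⟨n, rfl, rfl, rfl, -⟩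
      · exact h.le
      · rw [gamma_path]; simp
    rw [add_sub_cancel_left, add_sub_cancel_left, phi_canonical]
    have : (0 : ℝ) ≤ P.broken Pre a := by positivity
    linarith

/-- Certificates propagate along inner edges, provided that edges of canonical inner paths are only
used when they are recorded by `Pre`. -/
theorem Cert.inner_forward {i : ℕ}
    (hPre : ∀ a n : ℕ, z₁ = s₁ + a * P.idx j r → z₂ = s₂ + a * P.rise (P.idx j r) →
      x₁ = P.pathX j r n → x₂ = P.pathY j r n → i = j → Pre a n → Pre a (n + 1))
    (h : P.Cert j r s₁ s₂ Pre z₁ z₂ x₁ x₂ t) :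
    P.Cert j r s₁ s₂ Pre z₁ z₂ (x₁ + i) (x₂ + (2 * P.Q - (i : ℤ) ^ 2)) (t + 1) := by
  have hle := P.beta_step_le_one i j
  rcases h with h | ⟨a, h₁, h₂⟩ | ⟨a, h₁, h₂, k, h₃, h₄⟩
  · left; rw [gamma_add]; linarith
  · right; left
    exact ⟨a, h₁, by rw [gamma_add]; linarith⟩
  · right; right
    refine ⟨a, h₁, h₂, k + 1, by push_cast; linarith, ?_⟩
    rw [gamma_add]
    rcases h₄ with h | ⟨n, rfl, hx₁, hx₂, hn⟩
    · left; push_cast; linarith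
    · by_cases hij : i = j
      · right
        refine ⟨n + 1, by push_cast; ring, ?_, ?_, hPre a n h₁ h₂ hx₁ hx₂ hij hn⟩
        · subst hij; rw [hx₁]; unfold pathX; push_cast; ring
        · subst hij; rw [hx₂]; unfold pathY; push_cast; ring
      · left
        have := P.beta_step_lt_one hij
        rw [hx₁, hx₂, gamma_path]; push_cast; linarith

theorem Cert.inner_backward {i : ℕ} (hi : i < P.m)
    (h : P.Cert j r s₁ s₂ Pre z₁ z₂ (x₁ + i) (x₂ + (2 * P.Q - (i : ℤ) ^ 2)) t) :
    P.Cert j r s₁ s₂ Pre z₁ z₂ x₁ x₂ (t + 1) := by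
  have hpos := P.beta_step_pos j hi
  have hg := gamma_add (P := P) j r x₁ x₂ i (2 * P.Q - (i : ℤ) ^ 2)
  rcases h with h | ⟨a, h₁, h₂⟩ | ⟨a, h₁, h₂, k, h₃, h₄⟩
  · left; linarith
  · right; left
    exact ⟨a, h₁, by linarith⟩
  · right; right
    refine ⟨a, h₁, h₂, k + 1, by push_cast; linarith, .inl ?_⟩
    push_cast
    rcases h₄ with h | ⟨n, rfl, hx₁, hx₂, -⟩
    · linarith
    · rw [hx₁, hx₂, gamma_path] at hg
      push_cast
      linarith

theorem broken_succ (Pre : ℕ → ℕ → Prop) (a : ℕ) [Decidable (Pre a P.D)] :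
    P.broken Pre (a + 1) = P.broken Pre a + if Pre a P.D then 0 else 1 := by
  classical
  unfold broken
  rw [Finset.range_add_one, Finset.filter_insert]
  split_ifs <;> simp_all

theorem gamma_exit (i j r r' : ℕ) :
    P.gamma j r (P.pathX i r' P.D) (P.pathY i r' P.D) =
      P.gamma j r (P.pathX i r' 0) (P.pathY i r' 0) +
        P.D * P.beta j i (2 * P.Q - (i : ℤ) ^ 2) := by
  unfold gamma; rw [beta_path]; ring

theorem Cert.outer_backward {i r' : ℕ} (hi : i < P.m) (hj : j < P.m) (hr : r < P.R)
    (hr' : r' < P.R)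
    (h : P.Cert j r s₁ s₂ Pre (z₁ + P.idx i r') (z₂ + P.rise (P.idx i r'))
      (P.pathX i r' 0) (P.pathY i r' 0) t) :
    P.Cert j r s₁ s₂ Pre z₁ z₂ (P.pathX i r' P.D) (P.pathY i r' P.D) (t + P.L) := by
  have h' := h.potential_le
  have hs := backward_slack P hi hj hr' hr
  rw [add_sub_right_comm, add_sub_right_comm, phi_add] at h'
  left
  rw [gamma_exit]
  linarith

theorem Cert.outer_forward {i r' : ℕ} (hj : j < P.m) (hr : r < P.R)
    (hr' : r' < P.R) (hPre : ∀ a, Pre a 0)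
    (h : P.Cert j r s₁ s₂ Pre z₁ z₂ (P.pathX i r' P.D) (P.pathY i r' P.D) t) :
    P.Cert j r s₁ s₂ Pre (z₁ + P.idx i r') (z₂ + P.rise (P.idx i r'))
      (P.pathX i r' 0) (P.pathY i r' 0) (t + P.L) := by
  classical
  have hT : (P.T : ℝ) = P.L + P.D := by unfold T; push_cast; ring
  have hT₀ : (0 : ℝ) < P.T := by exact_mod_cast P.T_pos
  by_cases hij : i = j
  swap
  · have h' := h.potential_le
    have hs := forward_slack P hj hr' hr hij
    left
    rw [add_sub_right_comm, add_sub_right_comm, phi_add]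
    rw [gamma_exit] at h'
    linarith
  subst hij
  have hg := gamma_exit (P := P) i i r r'
  rw [beta_step_self, mul_one] at hg
  have hle := P.phi_step_le_one (P.idx i r) (P.idx i r')
  rcases h with h | ⟨a, h₁, h₂⟩ | ⟨a, rfl, rfl, k, h₃, h₄⟩
  · left
    rw [add_sub_right_comm, add_sub_right_comm, phi_add]
    nlinarith
  · right; left
    refine ⟨a + 1, ?_, by push_cast; linarith⟩
    rw [add_sub_right_comm, add_sub_right_comm, phi_add]
    push_cast; linarith
  · right
    by_cases hrr : r' = r
    · subst hrr
      right
      refine ⟨a + 1, by push_cast; ring, by push_cast; ring, 0, ?_, .inr ⟨0, rfl, rfl, rfl, hPre _⟩⟩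
      rw [broken_succ, gamma_path] at *
      have hk : (P.D : ℤ) + (if Pre a P.D then 0 else 1) ≤ k := by
        rcases h₄ with h | ⟨n, rfl, hx₁, hx₂, hn⟩
        · have : (P.D : ℤ) < k := by exact_mod_cast h
          split_ifs <;> omega
        · have hD : (P.D : ℝ) = n := by
            rw [← gamma_path (P := P) i r' n, ← hx₁, ← hx₂, gamma_path]
          have hD' : P.D = n := by exact_mod_cast hD
          subst hD'
          simp [hn]
      have hk' : (P.D : ℝ) + (if Pre a P.D then 0 else 1) ≤ k := by exact_mod_cast hk
      push_cast
      linarith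
    · left
      have hne : P.idx i r' ≠ P.idx i r := by unfold idx; omega
      have hlt := P.phi_step_lt_one hne
      refine ⟨a + 1, ?_, ?_⟩
      · rw [add_assoc s₁, add_assoc s₂, add_sub_cancel_left, add_sub_cancel_left, phi_add,
          phi_canonical]
        push_cast; linarith
      · have hk : P.gamma i r (P.pathX i r' P.D) (P.pathY i r' P.D) ≤ k := by
          rcases h₄ with h | ⟨n, rfl, hx₁, hx₂, hn⟩
          · exact h.le
          · rw [hx₁, hx₂, gamma_path]; simp
        have : (0 : ℝ) ≤ P.broken Pre a := by positivity
        push_cast; linarith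

theorem cert_start (hPre : ∀ a, Pre a 0) :
    P.Cert j r s₁ s₂ Pre s₁ s₂ (P.pathX j r 0) (P.pathY j r 0) 0 := by
  refine .inr (.inr ⟨0, by simp, by simp, 0, ?_, .inr ⟨0, rfl, rfl, rfl, hPre 0⟩⟩)
  simp [broken]

theorem Cert.length_ge {a : ℕ} (hb : P.e ≤ P.broken Pre a)
    (h : P.Cert j r s₁ s₂ Pre (s₁ + a * P.idx j r) (s₂ + a * P.rise (P.idx j r))
      (P.pathX j r 0) (P.pathY j r 0) t) :
    (P.T * a + P.e : ℝ) ≤ t := by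
  have hT₀ : (0 : ℝ) < P.T := by exact_mod_cast P.T_pos
  have hb' : (P.e : ℝ) ≤ P.broken Pre a := by exact_mod_cast hb
  unfold Cert at h
  simp only [add_sub_cancel_left, phi_canonical, gamma_path, Nat.cast_zero, add_zero] at h
  rcases h with h | ⟨c, h₁, h₂⟩ | ⟨c, h₁, h₂, k, h₃, h₄⟩
  · exact h
  · have hc : (a : ℤ) + 1 ≤ c := by
      have : (a : ℤ) < c := by exact_mod_cast h₁
      omega
    have hc' : (a : ℝ) + 1 ≤ c := by exact_mod_cast hc
    have he : (P.e : ℝ) ≤ P.T := by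
      have := e_le_L (P := P)
      have : P.e ≤ P.T := this.trans (Nat.le_add_right _ _)
      exact_mod_cast this
    nlinarith
  · have hac : (a : ℝ) = c := by
      rw [← phi_canonical (P := P) j r a, ← phi_canonical (P := P) j r c,
        add_left_cancel h₁, add_left_cancel h₂]
    have hac' : a = c := by exact_mod_cast hac
    subst hac'
    have hk : (0 : ℝ) ≤ k := by
      rcases h₄ with h | ⟨n, rfl, -⟩
      · exact h.le
      · simp
    linarith

end Cert

/-! ### Lower bound for spanning subgraphs -/

/-- The `k`-th edge of the inner path of port `r` and slope `i` at the node `(z₁, z₂)` is in `H`. -/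
def EdgeIn (H : SimpleGraph (P.Core ⊕ P.Mid)) (z₁ z₂ : ℤ) (i r k : ℕ) : Prop :=
  ∃ y y' : P.Core, H.Adj (.inl y) (.inl y') ∧ P.At y z₁ z₂ (P.pathX i r k) (P.pathY i r k) ∧
    P.At y' z₁ z₂ (P.pathX i r (k + 1)) (P.pathY i r (k + 1))

/-- The first `k` edges of the inner path at the `a`-th node of a canonical path survive in `H`. -/
def Survives (H : SimpleGraph (P.Core ⊕ P.Mid)) (j r : ℕ) (s₁ s₂ : ℤ) (a k : ℕ) : Prop :=
  ∀ n < k, P.EdgeIn H (s₁ + a * P.idx j r) (s₂ + a * P.rise (P.idx j r)) j r n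

/-- Certificates at arbitrary vertices. -/
def VertexCert (j r : ℕ) (s₁ s₂ : ℤ) (Pre : ℕ → ℕ → Prop) : P.Core ⊕ P.Mid → ℝ → Prop
  | .inl y, t => P.Cert j r s₁ s₂ Pre y.1 y.2.1 y.2.2.1 y.2.2.2 t
  | .inr w, t =>
      P.Cert j r s₁ s₂ Pre w.1.1 w.1.2 (P.pathX w.2.1.1 w.2.1.2 P.D) (P.pathY w.2.1.1 w.2.1.2 P.D)
        (t - ((w.2.2 : ℕ) + 1)) ∨
      P.Cert j r s₁ s₂ Pre ((w.1.1 : ℤ) + P.idx w.2.1.1 w.2.1.2)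
        ((w.1.2 : ℤ) + P.rise (P.idx w.2.1.1 w.2.1.2))
        (P.pathX w.2.1.1 w.2.1.2 0) (P.pathY w.2.1.1 w.2.1.2 0) (t - (P.mids - (w.2.2 : ℕ)))

section VertexCert

variable {P}
variable {H : SimpleGraph (P.Core ⊕ P.Mid)} {j r : ℕ} {s₁ s₂ : ℤ} {t : ℝ}

theorem VertexCert.step (hj : j < P.m) (hr : r < P.R) {a b : P.Core ⊕ P.Mid} (hab : H.Adj a b)
    (hrel : P.Rel a b) (h : P.VertexCert j r s₁ s₂ (P.Survives H j r s₁ s₂) a t) :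
    P.VertexCert j r s₁ s₂ (P.Survives H j r s₁ s₂) b (t + 1) := by
  have hPre : ∀ a, P.Survives H j r s₁ s₂ a 0 := fun a n hn => absurd hn n.not_lt_zero
  have hL : (P.L : ℝ) = P.mids + 1 := by unfold L; push_cast; ring
  rcases a with y | w <;> rcases b with y' | w'
  · obtain ⟨i, hi, h₁, h₂, h₃, h₄⟩ := hrel
    simp only [VertexCert] at h ⊢
    rw [h₁, h₂, h₃, h₄]
    refine h.inner_forward ?_
    intro a n hz₁ hz₂ hx₁ hx₂ hij hn k hk
    rcases Nat.lt_succ_iff_lt_or_eq.1 hk with hk | rfl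
    · exact hn k hk
    · subst hij
      refine ⟨y, y', hab, ⟨hz₁, hz₂, hx₁, hx₂⟩, h₁.trans hz₁, h₂.trans hz₂, ?_, ?_⟩
      · rw [h₃, hx₁]; unfold pathX; push_cast; ring
      · rw [h₄, hx₂]; unfold pathY; push_cast; ring
  · obtain ⟨hk, h₁, h₂, h₃, h₄⟩ := hrel
    simp only [VertexCert] at h ⊢
    rw [h₁, h₂, h₃, h₄] at h
    left
    rw [hk]
    exact h.mono (by simp)
  · obtain ⟨hk, h₁, h₂, h₃, h₄⟩ := hrel
    have hk' : ((w.2.2 : ℕ) : ℝ) + 1 = P.mids := by exact_mod_cast hk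
    simp only [VertexCert] at h ⊢
    rw [h₁, h₂, h₃, h₄]
    rcases h with h | h
    · exact (h.outer_forward hj hr w.2.1.2.2 hPre).mono (by linarith)
    · exact h.mono (by linarith)
  · obtain ⟨h₁, h₂, h₃⟩ := hrel
    have h₃' : ((w'.2.2 : ℕ) : ℝ) = (w.2.2 : ℕ) + 1 := by exact_mod_cast h₃
    simp only [VertexCert] at h ⊢
    rw [h₁, h₂, h₃']
    rcases h with h | h
    · exact .inl (h.mono (by linarith))
    · exact .inr (h.mono (by linarith))

theorem VertexCert.step_back (hj : j < P.m) (hr : r < P.R) {a b : P.Core ⊕ P.Mid}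
    (hrel : P.Rel a b) (h : P.VertexCert j r s₁ s₂ (P.Survives H j r s₁ s₂) b t) :
    P.VertexCert j r s₁ s₂ (P.Survives H j r s₁ s₂) a (t + 1) := by
  have hL : (P.L : ℝ) = P.mids + 1 := by unfold L; push_cast; ring
  rcases a with y | w <;> rcases b with y' | w'
  · obtain ⟨i, hi, h₁, h₂, h₃, h₄⟩ := hrel
    simp only [VertexCert] at h ⊢
    rw [h₁, h₂, h₃, h₄] at h
    exact h.inner_backward hi
  · obtain ⟨hk, h₁, h₂, h₃, h₄⟩ := hrel
    simp only [VertexCert] at h ⊢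
    rw [h₁, h₂, h₃, h₄]
    rw [hk] at h
    simp only [Nat.cast_zero] at h
    rcases h with h | h
    · exact h.mono (by linarith)
    · exact (h.outer_backward w'.2.1.1.2 hj hr w'.2.1.2.2).mono (by linarith)
  · obtain ⟨hk, h₁, h₂, h₃, h₄⟩ := hrel
    have hk' : ((w.2.2 : ℕ) : ℝ) + 1 = P.mids := by exact_mod_cast hk
    simp only [VertexCert] at h ⊢
    rw [h₁, h₂, h₃, h₄] at h
    exact .inr (h.mono (by linarith))
  · obtain ⟨h₁, h₂, h₃⟩ := hrel
    have h₃' : ((w'.2.2 : ℕ) : ℝ) = (w.2.2 : ℕ) + 1 := by exact_mod_cast h₃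
    simp only [VertexCert] at h ⊢
    rw [h₁, h₂, h₃'] at h
    rcases h with h | h
    · exact .inl (h.mono (by linarith))
    · exact .inr (h.mono (by linarith))

theorem VertexCert.walk (hj : j < P.m) (hr : r < P.R) (hH : H ≤ P.graph)
    {a b : P.Core ⊕ P.Mid} (p : H.Walk a b)
    (h : P.VertexCert j r s₁ s₂ (P.Survives H j r s₁ s₂) a t) :
    P.VertexCert j r s₁ s₂ (P.Survives H j r s₁ s₂) b (t + p.length) := by
  induction p generalizing t with
  | nil => simpa using h
  | @cons a b c hab p ih =>
    have h' : P.VertexCert j r s₁ s₂ (P.Survives H j r s₁ s₂) b (t + 1) := by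
      obtain ⟨-, hrel | hrel⟩ := (SimpleGraph.fromRel_adj _ _ _).1 (hH hab)
      · exact h.step hj hr hab hrel
      · exact h.step_back hj hr hrel
    have := ih h'
    rw [SimpleGraph.Walk.length_cons]
    push_cast
    rwa [add_comm (p.length : ℝ), ← add_assoc]

/-- Walks in a subgraph that breaks at least `e` inner paths are long. -/
theorem le_walk_length (hj : j < P.m) (hr : r < P.R) (hH : H ≤ P.graph) {a : ℕ}
    (hb : P.e ≤ P.broken (P.Survives H j r s₁ s₂) a) {y y' : P.Core}
    (hy : P.At y s₁ s₂ (P.pathX j r 0) (P.pathY j r 0))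
    (hy' : P.At y' (s₁ + a * P.idx j r) (s₂ + a * P.rise (P.idx j r))
      (P.pathX j r 0) (P.pathY j r 0))
    (p : H.Walk (.inl y) (.inl y')) : P.T * a + P.e ≤ p.length := by
  have hPre : ∀ a, P.Survives H j r s₁ s₂ a 0 := fun a n hn => absurd hn n.not_lt_zero
  have h₀ : P.VertexCert j r s₁ s₂ (P.Survives H j r s₁ s₂) (.inl y) 0 := by
    obtain ⟨h₁, h₂, h₃, h₄⟩ := hy
    simp only [VertexCert]
    rw [h₁, h₂, h₃, h₄]
    exact cert_start hPre
  have h := h₀.walk hj hr hH p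
  obtain ⟨h₁, h₂, h₃, h₄⟩ := hy'
  simp only [VertexCert] at h
  rw [h₁, h₂, h₃, h₄] at h
  have := h.length_ge hb
  rw [zero_add] at this
  exact_mod_cast this

end VertexCert

/-! ### Canonical paths -/

section Canonical

variable {P}

theorem At.unique {y y' : P.Core} {z₁ z₂ x₁ x₂ : ℤ} (h : P.At y z₁ z₂ x₁ x₂)
    (h' : P.At y' z₁ z₂ x₁ x₂) : y = y' := by
  obtain ⟨h₁, h₂, h₃, h₄⟩ := h
  obtain ⟨h₁', h₂', h₃', h₄'⟩ := h'
  ext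
  · exact_mod_cast h₁.trans h₁'.symm
  · exact_mod_cast h₂.trans h₂'.symm
  · exact_mod_cast h₃.trans h₃'.symm
  · exact_mod_cast h₄.trans h₄'.symm

/-- Coordinates of an outer node of the graph. -/
def InBox (P : ObstacleParams) (z₁ z₂ : ℤ) : Prop :=
  0 ≤ z₁ ∧ z₁ < 2 * P.A ∧ 0 ≤ z₂ ∧ z₂ < 2 * P.B

theorem exists_core {z₁ z₂ : ℤ} (hz : P.InBox z₁ z₂) {i r k : ℕ} (hi : i < P.m) (hr : r < P.R)
    (hk : k ≤ P.D) : ∃ y, P.At y z₁ z₂ (P.pathX i r k) (P.pathY i r k) := by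
  obtain ⟨h₁, h₂, h₃, h₄⟩ := hz
  have hQ := P.Q_pos
  have hdiv : r / P.Q < P.D * P.m := (Nat.div_lt_iff_lt_mul hQ).2 hr
  have hmod : r % P.Q < P.Q := Nat.mod_lt _ hQ
  have hx : k * i ≤ P.D * P.m := Nat.mul_le_mul hk hi.le
  have hsq := sq_le_Q hi
  have hstep : i ^ 2 ≤ 2 * P.Q := by omega
  have hy : k * (2 * P.Q - i ^ 2) ≤ P.D * (2 * P.Q) := Nat.mul_le_mul hk (Nat.sub_le _ _)
  refine ⟨⟨⟨z₁.toNat, by omega⟩, ⟨z₂.toNat, by omega⟩, ⟨r / P.Q + k * i, ?_⟩,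
    ⟨r % P.Q + k * (2 * P.Q - i ^ 2), ?_⟩⟩, ?_, ?_, ?_, ?_⟩
  · calc r / P.Q + k * i < P.D * P.m + P.D * P.m := by omega
      _ = 2 * P.D * P.m := by ring
  · calc r % P.Q + k * (2 * P.Q - i ^ 2) < P.Q + P.D * (2 * P.Q) := by omega
      _ = P.Q + 2 * P.Q * P.D := by ring
  · exact Int.toNat_of_nonneg h₁
  · exact Int.toNat_of_nonneg h₃
  · simp [pathX]
  · simp [pathY, Nat.cast_sub hstep]

theorem inBox_line {s₁ s₂ i r a : ℕ} (hs₁ : s₁ < P.A) (hs₂ : s₂ < P.B) (hi : i < P.m)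
    (hr : r < P.R) (ha : a ≤ P.ell) :
    P.InBox ((s₁ : ℤ) + a * P.idx i r) ((s₂ : ℤ) + a * P.rise (P.idx i r)) := by
  have h₁ : a * P.idx i r ≤ P.A := Nat.mul_le_mul ha (idx_le hi hr)
  have hsq := idx_sq_le_Z hi hr
  have hrise : P.rise (P.idx i r) = ((P.Z - P.idx i r ^ 2 : ℕ) : ℤ) := by
    rw [Nat.cast_sub hsq]; simp [rise]
  have h₂ : a * (P.Z - P.idx i r ^ 2) ≤ P.B := Nat.mul_le_mul ha (Nat.sub_le _ _)
  rw [hrise]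
  norm_cast
  refine ⟨?_, ?_, ?_, ?_⟩ <;> norm_cast <;> omega

theorem exists_inner_walk {z₁ z₂ : ℤ} (hz : P.InBox z₁ z₂) {i r k : ℕ} (hi : i < P.m)
    (hr : r < P.R) (hk : k ≤ P.D) {y y' : P.Core}
    (hy : P.At y z₁ z₂ (P.pathX i r 0) (P.pathY i r 0))
    (hy' : P.At y' z₁ z₂ (P.pathX i r k) (P.pathY i r k)) :
    ∃ p : P.graph.Walk (.inl y) (.inl y'), p.length = k := by
  induction k generalizing y' with
  | zero =>
    obtain rfl := hy.unique hy'
    exact ⟨.nil, rfl⟩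
  | succ k ih =>
    obtain ⟨x, hx⟩ := exists_core hz hi hr (k := k) (by omega)
    obtain ⟨p, hp⟩ := ih (by omega) hx
    obtain ⟨a₁, a₂, a₃, a₄⟩ := hx
    obtain ⟨b₁, b₂, b₃, b₄⟩ := hy'
    have hc : (y'.2.2.2 : ℤ) = (x.2.2.2 : ℤ) + (2 * P.Q - (i : ℤ) ^ 2) := by
      rw [b₄, a₄]; unfold pathY; push_cast; ring
    have hadj : P.graph.Adj (.inl x) (.inl y') := by
      refine (SimpleGraph.fromRel_adj _ _ _).2 ⟨?_, .inl ⟨i, hi, ?_, ?_, ?_, hc⟩⟩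
      · intro h
        obtain rfl := Sum.inl_injective h
        have h₁ : ((i ^ 2 : ℕ) : ℤ) ≤ P.Q := by exact_mod_cast sq_le_Q hi
        have h₂ : (0 : ℤ) < P.Q := by exact_mod_cast P.Q_pos
        push_cast at h₁
        omega
      · rw [b₁, a₁]
      · rw [b₂, a₂]
      · rw [b₃, a₃]; unfold pathX; push_cast; ring
    exact ⟨p.concat hadj, by rw [SimpleGraph.Walk.length_concat, hp]⟩

theorem exists_outer_walk {z₁ z₂ : ℤ} {i r : ℕ} (hi : i < P.m) (hr : r < P.R)
    {y y' : P.Core} (hy : P.At y z₁ z₂ (P.pathX i r P.D) (P.pathY i r P.D))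
    (hy' : P.At y' (z₁ + P.idx i r) (z₂ + P.rise (P.idx i r)) (P.pathX i r 0) (P.pathY i r 0)) :
    ∃ p : P.graph.Walk (.inl y) (.inl y'), p.length = P.L := by
  obtain ⟨a₁, a₂, a₃, a₄⟩ := hy
  obtain ⟨b₁, b₂, b₃, b₄⟩ := hy'
  let mid : Fin P.mids → P.Mid := fun k => ((y.1, y.2.1), (⟨i, hi⟩, ⟨r, hr⟩), k)
  have hmid : ∀ k (hk : k < P.mids),
      ∃ p : P.graph.Walk (.inl y) (.inr (mid ⟨k, hk⟩)), p.length = k + 1 := by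
    intro k
    induction k with
    | zero =>
      intro hk
      have hadj : P.graph.Adj (.inl y) (.inr (mid ⟨0, hk⟩)) :=
        (SimpleGraph.fromRel_adj _ _ _).2 ⟨Sum.inl_ne_inr, .inl ⟨rfl, rfl, rfl, a₃, a₄⟩⟩
      exact ⟨hadj.toWalk, rfl⟩
    | succ k ih =>
      intro hk
      obtain ⟨p, hp⟩ := ih (by omega)
      have hadj : P.graph.Adj (.inr (mid ⟨k, by omega⟩)) (.inr (mid ⟨k + 1, hk⟩)) :=
        (SimpleGraph.fromRel_adj _ _ _).2 ⟨by simp [mid], .inl ⟨rfl, rfl, rfl⟩⟩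
      exact ⟨p.concat hadj, by rw [SimpleGraph.Walk.length_concat, hp]⟩
  have hpos := P.mids_pos
  obtain ⟨p, hp⟩ := hmid (P.mids - 1) (by omega)
  have hadj : P.graph.Adj (.inr (mid ⟨P.mids - 1, by omega⟩)) (.inl y') := by
    refine (SimpleGraph.fromRel_adj _ _ _).2
      ⟨Sum.inr_ne_inl, .inl ⟨Nat.sub_add_cancel hpos, ?_, ?_, b₃, b₄⟩⟩
    · rw [b₁, ← a₁]
    · rw [b₂, ← a₂]
  refine ⟨p.concat hadj, ?_⟩
  rw [SimpleGraph.Walk.length_concat, hp]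
  unfold L
  omega

theorem exists_canonical_walk {s₁ s₂ i r a : ℕ} (hs₁ : s₁ < P.A) (hs₂ : s₂ < P.B) (hi : i < P.m)
    (hr : r < P.R) (ha : a ≤ P.ell) {y y' : P.Core}
    (hy : P.At y s₁ s₂ (P.pathX i r 0) (P.pathY i r 0))
    (hy' : P.At y' (s₁ + a * P.idx i r) (s₂ + a * P.rise (P.idx i r))
      (P.pathX i r 0) (P.pathY i r 0)) :
    ∃ p : P.graph.Walk (.inl y) (.inl y'), p.length = P.T * a := by
  induction a generalizing y' with
  | zero =>
    simp only [Nat.cast_zero, zero_mul, add_zero] at hy'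
    obtain rfl := hy.unique hy'
    exact ⟨.nil, rfl⟩
  | succ a ih =>
    have hbox := inBox_line hs₁ hs₂ hi hr (a := a) (by omega)
    obtain ⟨x, hx⟩ := exists_core hbox hi hr (Nat.zero_le _)
    obtain ⟨x', hx'⟩ := exists_core hbox hi hr le_rfl
    obtain ⟨p, hp⟩ := ih (by omega) hx
    obtain ⟨p', hp'⟩ := exists_inner_walk hbox hi hr le_rfl hx hx'
    obtain ⟨p'', hp''⟩ := exists_outer_walk (y' := y') hi hr hx' (by
      convert hy' using 1 <;> push_cast <;> ring)
    refine ⟨(p.append p').append p'', ?_⟩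
    rw [SimpleGraph.Walk.length_append, SimpleGraph.Walk.length_append, hp, hp', hp'']
    unfold T
    ring

end Canonical

/-! ### Counting surviving inner paths -/

section Counting

variable {P}

theorem path_injective {i r r' k k' : ℕ} (hi : i < P.m) (hx : P.pathX i r k = P.pathX i r' k')
    (hy : P.pathY i r k = P.pathY i r' k') : r = r' ∧ k = k' := by
  have hQ := P.Q_pos
  have hsq : ((i ^ 2 : ℕ) : ℤ) ≤ P.Q := by exact_mod_cast sq_le_Q hi
  have h₁ : ((r % P.Q : ℕ) : ℤ) < P.Q := by exact_mod_cast Nat.mod_lt r hQ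
  have h₂ : ((r' % P.Q : ℕ) : ℤ) < P.Q := by exact_mod_cast Nat.mod_lt r' hQ
  have h₃ : (0 : ℤ) ≤ ((r % P.Q : ℕ) : ℤ) := Int.natCast_nonneg _
  have h₄ : (0 : ℤ) ≤ ((r' % P.Q : ℕ) : ℤ) := Int.natCast_nonneg _
  unfold pathX at hx
  unfold pathY at hy
  push_cast at hsq
  have hk : k = k' := by
    rcases lt_trichotomy k k' with h | h | h
    · have h' : (k : ℤ) + 1 ≤ k' := by exact_mod_cast h
      nlinarith
    · exact h
    · have h' : (k' : ℤ) + 1 ≤ k := by exact_mod_cast h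
      nlinarith
  subst hk
  have hd : r / P.Q = r' / P.Q := by exact_mod_cast add_right_cancel hx
  have hm : r % P.Q = r' % P.Q := by exact_mod_cast add_right_cancel hy
  refine ⟨?_, rfl⟩
  rw [← Nat.div_add_mod r P.Q, ← Nat.div_add_mod r' P.Q, hd, hm]

/-- At a fixed position along the canonical paths, surviving inner paths are edge-disjoint. -/
theorem card_mul_le_ncard_edgeSet (H : SimpleGraph (P.Core ⊕ P.Mid)) (a : ℕ)
    (F : Finset (ℕ × ℕ × ℕ × ℕ))
    (hF : ∀ x ∈ F, x.2.2.1 < P.m ∧ P.Survives H x.2.2.1 x.2.2.2 x.1 x.2.1 a P.D) :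
    F.card * P.D ≤ H.edgeSet.ncard := by
  classical
  rcases F.eq_empty_or_nonempty with rfl | ⟨x₀, hx₀⟩
  · simp
  obtain ⟨y₀, -⟩ := (hF x₀ hx₀).2 0 P.D_pos
  have hex : ∀ x : (ℕ × ℕ × ℕ × ℕ) × ℕ, ∃ e : Sym2 (P.Core ⊕ P.Mid),
      x ∈ F ×ˢ Finset.range P.D → e ∈ H.edgeSet ∧ ∃ y y' : P.Core, e = s(.inl y, .inl y') ∧
        P.At y (x.1.1 + a * P.idx x.1.2.2.1 x.1.2.2.2)
          (x.1.2.1 + a * P.rise (P.idx x.1.2.2.1 x.1.2.2.2))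
          (P.pathX x.1.2.2.1 x.1.2.2.2 x.2) (P.pathY x.1.2.2.1 x.1.2.2.2 x.2) ∧
        P.At y' (x.1.1 + a * P.idx x.1.2.2.1 x.1.2.2.2)
          (x.1.2.1 + a * P.rise (P.idx x.1.2.2.1 x.1.2.2.2))
          (P.pathX x.1.2.2.1 x.1.2.2.2 (x.2 + 1)) (P.pathY x.1.2.2.1 x.1.2.2.2 (x.2 + 1)) := by
    intro x
    by_cases hx : x ∈ F ×ˢ Finset.range P.D
    · obtain ⟨hx₁, hx₂⟩ := Finset.mem_product.1 hx
      obtain ⟨y, y', hadj, hy, hy'⟩ := (hF _ hx₁).2 x.2 (Finset.mem_range.1 hx₂)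
      exact ⟨s(.inl y, .inl y'), fun _ => ⟨hadj, y, y', rfl, hy, hy'⟩⟩
    · exact ⟨s(.inl y₀, .inl y₀), fun h => absurd h hx⟩
  choose f hf using hex
  have hcard : F.card * P.D = (↑(F ×ˢ Finset.range P.D) : Set ((ℕ × ℕ × ℕ × ℕ) × ℕ)).ncard := by
    rw [Set.ncard_coe_finset, Finset.card_product, Finset.card_range]
  rw [hcard]
  refine Set.ncard_le_ncard_of_injOn f (fun x hx => (hf x hx).1) ?_ (Set.toFinite _)
  rintro ⟨⟨s₁, s₂, i, r⟩, k⟩ hx ⟨⟨s₁', s₂', i', r'⟩, k'⟩ hx' hxx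
  obtain ⟨-, y, y', he, ⟨a₁, a₂, a₃, a₄⟩, b₁, b₂, b₃, b₄⟩ := hf _ hx
  obtain ⟨-, w, w', he', ⟨c₁, c₂, c₃, c₄⟩, d₁, d₂, d₃, d₄⟩ := hf _ hx'
  have hi : i < P.m := (hF _ (Finset.mem_product.1 hx).1).1
  have hi' : i' < P.m := (hF _ (Finset.mem_product.1 hx').1).1
  have hQ : (0 : ℤ) < P.Q := by exact_mod_cast P.Q_pos
  have hsq : ((i ^ 2 : ℕ) : ℤ) ≤ P.Q := by exact_mod_cast sq_le_Q hi
  have hsq' : ((i' ^ 2 : ℕ) : ℤ) ≤ P.Q := by exact_mod_cast sq_le_Q hi'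
  push_cast at hsq hsq'
  simp only at a₁ a₂ a₃ a₄ b₁ b₂ b₃ b₄ c₁ c₂ c₃ c₄ d₁ d₂ d₃ d₄
  have hstep : P.pathY i r (k + 1) = P.pathY i r k + (2 * P.Q - (i : ℤ) ^ 2) := by
    unfold pathY; push_cast; ring
  have hstep' : P.pathY i' r' (k' + 1) = P.pathY i' r' k' + (2 * P.Q - (i' : ℤ) ^ 2) := by
    unfold pathY; push_cast; ring
  have hstepX : P.pathX i r (k + 1) = P.pathX i r k + i := by
    unfold pathX; push_cast; ring
  have hstepX' : P.pathX i' r' (k' + 1) = P.pathX i' r' k' + i' := by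
    unfold pathX; push_cast; ring
  rw [he, he', Sym2.eq_iff] at hxx
  rcases hxx with ⟨h₁, h₂⟩ | ⟨h₁, h₂⟩
  · obtain rfl := Sum.inl_injective h₁
    obtain rfl := Sum.inl_injective h₂
    have hii : i = i' := by
      have : (i : ℤ) = i' := by linarith
      exact_mod_cast this
    subst hii
    obtain ⟨rfl, rfl⟩ := path_injective hi (a₃.symm.trans c₃) (a₄.symm.trans c₄)
    have e₁ : s₁ = s₁' := by exact_mod_cast add_right_cancel (a₁.symm.trans c₁)
    have e₂ : s₂ = s₂' := by exact_mod_cast add_right_cancel (a₂.symm.trans c₂)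
    subst e₁ e₂
    rfl
  · obtain rfl := Sum.inl_injective h₁
    obtain rfl := Sum.inl_injective h₂
    linarith

theorem A_pos (h : 0 < P.ell) : 0 < P.A :=
  Nat.mul_pos h (Nat.mul_pos (Nat.mul_pos two_pos P.m_pos) P.R_pos)

theorem B_pos (h : 0 < P.ell) : 0 < P.B := Nat.mul_pos h P.Z_pos

theorem exists_broken (H : SimpleGraph (P.Core ⊕ P.Mid)) (hell : 0 < P.ell)
    (hH : 2 * H.edgeSet.ncard ≤ P.A * P.B * P.m * P.R * P.D) :
    ∃ s₁ < P.A, ∃ s₂ < P.B, ∃ i < P.m, ∃ r < P.R,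
      P.ell ≤ 2 * P.broken (P.Survives H i r s₁ s₂) P.ell := by
  classical
  by_contra! hcon
  let S := Finset.range P.A ×ˢ Finset.range P.B ×ˢ Finset.range P.m ×ˢ Finset.range P.R
  let good : ℕ → ℕ × ℕ × ℕ × ℕ → Prop := fun a x => P.Survives H x.2.2.1 x.2.2.2 x.1 x.2.1 a P.D
  have hS : S.card = P.A * P.B * P.m * P.R := by
    simp only [S, Finset.card_product, Finset.card_range]; ring
  have hgood : ∀ x ∈ S, P.ell + 1 ≤ 2 * ((Finset.range P.ell).filter fun a => good a x).card := by
    rintro ⟨s₁, s₂, i, r⟩ hx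
    simp only [S, Finset.mem_product, Finset.mem_range] at hx
    have h := hcon s₁ hx.1 s₂ hx.2.1 i hx.2.2.1 r hx.2.2.2
    have hsum := Finset.card_filter_add_card_filter_not (s := Finset.range P.ell)
      (fun a => good a (s₁, s₂, i, r))
    rw [Finset.card_range] at hsum
    have hb : P.broken (P.Survives H i r s₁ s₂) P.ell =
      ((Finset.range P.ell).filter fun a => ¬ good a (s₁, s₂, i, r)).card := by
      unfold broken
      congr
    omega
  have hcol : ∀ a, (S.filter fun x => good a x).card * P.D ≤ H.edgeSet.ncard := by
    intro a
    refine card_mul_le_ncard_edgeSet H a _ fun x hx => ?_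
    obtain ⟨hx, hg⟩ := Finset.mem_filter.1 hx
    simp only [S, Finset.mem_product, Finset.mem_range] at hx
    exact ⟨hx.2.2.1, hg⟩
  have hswap : ∑ x ∈ S, ((Finset.range P.ell).filter fun a => good a x).card =
      ∑ a ∈ Finset.range P.ell, (S.filter fun x => good a x).card := by
    simp only [Finset.card_filter]
    exact Finset.sum_comm
  have h₁ : S.card * (P.ell + 1) ≤
      2 * ∑ x ∈ S, ((Finset.range P.ell).filter fun a => good a x).card := by
    rw [Finset.mul_sum, ← smul_eq_mul]
    exact Finset.card_nsmul_le_sum _ _ _ hgood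
  have h₂ : (∑ a ∈ Finset.range P.ell, (S.filter fun x => good a x).card) * P.D ≤
      P.ell * H.edgeSet.ncard := by
    rw [Finset.sum_mul]
    refine (Finset.sum_le_card_nsmul _ _ _ fun a _ => hcol a).trans ?_
    simp
  rw [hswap] at h₁
  rw [← hS] at hH
  have hSD : 0 < S.card * P.D := by
    rw [hS]
    exact Nat.mul_pos (Nat.mul_pos (Nat.mul_pos (Nat.mul_pos (A_pos hell) (B_pos hell)) P.m_pos)
      P.R_pos) P.D_pos
  have h₃ : S.card * P.D * (P.ell + 1) ≤ S.card * P.D * P.ell :=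
    calc S.card * P.D * (P.ell + 1) = S.card * (P.ell + 1) * P.D := by ring
      _ ≤ 2 * (∑ a ∈ Finset.range P.ell, (S.filter fun x => good a x).card) * P.D :=
        Nat.mul_le_mul_right _ h₁
      _ = 2 * ((∑ a ∈ Finset.range P.ell, (S.filter fun x => good a x).card) * P.D) := by ring
      _ ≤ 2 * (P.ell * H.edgeSet.ncard) := Nat.mul_le_mul_left _ h₂
      _ = P.ell * (2 * H.edgeSet.ncard) := by ring
      _ ≤ P.ell * (S.card * P.D) := Nat.mul_le_mul_left _ hH
      _ = S.card * P.D * P.ell := by ring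
  nlinarith

/-- Sparse subgraphs of the obstacle product have additive distortion at least `e`. -/
theorem exists_stretched_pair (H : SimpleGraph (P.Core ⊕ P.Mid)) (hle : H ≤ P.graph)
    (he : 0 < P.e) (hell : P.ell = 2 * P.e)
    (hH : 2 * H.edgeSet.ncard ≤ P.A * P.B * P.m * P.R * P.D) :
    ∃ (u v : P.Core ⊕ P.Mid) (p : P.graph.Walk u v), ∀ q : H.Walk u v,
      p.length + P.e ≤ q.length := by
  obtain ⟨s₁, hs₁, s₂, hs₂, i, hi, r, hr, hb⟩ := exists_broken H (by omega) hH
  have hbox := inBox_line hs₁ hs₂ hi hr (Nat.zero_le _)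
  simp only [Nat.cast_zero, zero_mul, add_zero] at hbox
  obtain ⟨y, hy⟩ := exists_core hbox hi hr (Nat.zero_le _)
  obtain ⟨y', hy'⟩ := exists_core (inBox_line hs₁ hs₂ hi hr le_rfl) hi hr (Nat.zero_le _)
  obtain ⟨p, hp⟩ := exists_canonical_walk hs₁ hs₂ hi hr le_rfl hy hy'
  exact ⟨_, _, p, fun q => hp ▸ le_walk_length hi hr hle (by omega) hy hy' q⟩

end Counting

theorem card_vertices : Fintype.card (P.Core ⊕ P.Mid) =
    4 * P.A * P.B * (2 * P.D * P.m * (P.Q + 2 * P.Q * P.D) + P.m * P.R * P.mids) := by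
  simp only [Fintype.card_sum, Fintype.card_prod, Fintype.card_fin]
  ring

/-! ### Choice of parameters -/

/-- Parameters for spanners with `c` edges per vertex and additive error `e`. -/
def spanner (c e : ℕ) (hc : 0 < c) (he : 0 < e) : ObstacleParams where
  m := 96 * c
  Y := 4 * (96 * c) ^ 2 * (16 * c + 1)
  D := 16 * c * (2 * (4 * (96 * c) ^ 2 * (16 * c + 1) + 4 * (96 * c) ^ 2) * e)
  mids := 2 * (4 * (96 * c) ^ 2 * (16 * c + 1) + 4 * (96 * c) ^ 2) * e - 1
  ell := 2 * e
  e := e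
  m_pos := by positivity
  D_pos := by positivity
  mids_pos := by
    have h₁ : 1 ≤ (96 * c) ^ 2 := Nat.one_le_pow _ _ (by positivity)
    have h₂ : 1 ≤ 4 * (96 * c) ^ 2 * (16 * c + 1) + 4 * (96 * c) ^ 2 := by omega
    have h₃ := Nat.mul_le_mul h₂ he
    have h₄ : 2 * (4 * (96 * c) ^ 2 * (16 * c + 1) + 4 * (96 * c) ^ 2) * e =
      2 * ((4 * (96 * c) ^ 2 * (16 * c + 1) + 4 * (96 * c) ^ 2) * e) := by ring
    omega
  slope_bound := by
    rw [Nat.sub_add_cancel (Nat.succ_le_of_lt (by positivity))]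
    apply le_of_eq
    ring
  gap_bound := by
    rw [Nat.sub_add_cancel (Nat.succ_le_of_lt (by positivity))]

variable {c e : ℕ} (hc : 0 < c) (he : 0 < e)

theorem spanner_D : (spanner c e hc he).D = 16 * c * (spanner c e hc he).L := by
  have : (spanner c e hc he).L =
      2 * (4 * (96 * c) ^ 2 * (16 * c + 1) + 4 * (96 * c) ^ 2) * e :=
    Nat.sub_add_cancel (Nat.succ_le_of_lt (by positivity))
  rw [this]
  rfl

theorem spanner_dense : 8 * c * (2 * (spanner c e hc he).D * (spanner c e hc he).m *
      ((spanner c e hc he).Q + 2 * (spanner c e hc he).Q * (spanner c e hc he).D) +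
        (spanner c e hc he).m * (spanner c e hc he).R * (spanner c e hc he).mids) ≤
      (spanner c e hc he).m * (spanner c e hc he).R * (spanner c e hc he).D := by
  have hD := spanner_D hc he
  have hm : (spanner c e hc he).m = 96 * c := rfl
  have hL : (spanner c e hc he).mids ≤ (spanner c e hc he).L := Nat.le_succ _
  have hD₁ : 1 ≤ (spanner c e hc he).D := (spanner c e hc he).D_pos
  have hR : 2 * (spanner c e hc he).D * (spanner c e hc he).m *
      ((spanner c e hc he).Q + 2 * (spanner c e hc he).Q * (spanner c e hc he).D) =
      (spanner c e hc he).R * (2 + 4 * (spanner c e hc he).D) := by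
    unfold R; ring
  rw [hR]
  generalize spanner c e hc he = P at *
  calc 8 * c * (P.R * (2 + 4 * P.D) + P.m * P.R * P.mids)
      ≤ 8 * c * (P.R * (6 * P.D) + P.m * P.R * P.L) := by gcongr; omega
    _ = P.R * (P.D * (48 * c)) + P.m * P.R * (8 * c * P.L) := by ring
    _ = P.m * P.R * P.D := by rw [hm, hD]; ring

theorem spanner_sparse :
    8 * c * Fintype.card ((spanner c e hc he).Core ⊕ (spanner c e hc he).Mid) ≤
      4 * ((spanner c e hc he).A * (spanner c e hc he).B * (spanner c e hc he).m *
        (spanner c e hc he).R * (spanner c e hc he).D) := by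
  rw [card_vertices]
  have h := spanner_dense hc he
  generalize spanner c e hc he = P at *
  calc _ = 4 * P.A * P.B * (8 * c * (2 * P.D * P.m * (P.Q + 2 * P.Q * P.D) +
        P.m * P.R * P.mids)) := by ring
    _ ≤ 4 * P.A * P.B * (P.m * P.R * P.D) := Nat.mul_le_mul_left _ h
    _ = _ := by ring

theorem spanner_card_le :
    Fintype.card ((spanner c e hc he).Core ⊕ (spanner c e hc he).Mid) ≤
      (2 ^ 38 * c ^ 6 * e) ^ 7 := by
  have h := spanner_sparse hc he
  have hY : (spanner c e hc he).Y ≤ 663552 * c ^ 3 := by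
    change 4 * (96 * c) ^ 2 * (16 * c + 1) ≤ _
    nlinarith [Nat.mul_le_mul_left (c ^ 2) hc]
  have hQ : (spanner c e hc he).Q ≤ 663552 * c ^ 3 := by
    change 4 * (96 * c) ^ 2 * (16 * c + 1) + 4 * (96 * c) ^ 2 ≤ _
    nlinarith [Nat.mul_le_mul_left (c ^ 2) hc]
  have hD : (spanner c e hc he).D ≤ 32 * 663552 * c ^ 4 * e := by
    have : (spanner c e hc he).D = 32 * c * (spanner c e hc he).Q * e := by
      change 16 * c * (2 * _ * e) = 32 * c * _ * e
      rw [Q]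
      change 16 * c * (2 * _ * e) = 32 * c * (4 * (96 * c) ^ 2 * (16 * c + 1) + 4 * (96 * c) ^ 2) * e
      ring
    rw [this]
    calc 32 * c * (spanner c e hc he).Q * e ≤ 32 * c * (663552 * c ^ 3) * e := by gcongr
      _ = _ := by ring
  have hm : (spanner c e hc he).m = 96 * c := rfl
  have hell : (spanner c e hc he).ell = 2 * e := rfl
  generalize spanner c e hc he = P at *
  have hR : P.R ≤ 3072 * 663552 ^ 2 * c ^ 8 * e := by
    calc P.R = P.D * (96 * c) * P.Q := by rw [← hm]; rfl
      _ ≤ 32 * 663552 * c ^ 4 * e * (96 * c) * (663552 * c ^ 3) := by gcongr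
      _ = _ := by ring
  calc Fintype.card (P.Core ⊕ P.Mid) ≤ 8 * c * Fintype.card (P.Core ⊕ P.Mid) :=
        Nat.le_mul_of_pos_left _ (by positivity)
    _ ≤ 4 * (P.A * P.B * P.m * P.R * P.D) := h
    _ = 32 * e ^ 2 * (96 * c) ^ 2 * P.Y * P.R ^ 4 * P.D := by
        unfold A B Z; rw [hm, hell]; ring
    _ ≤ 32 * e ^ 2 * (96 * c) ^ 2 * (663552 * c ^ 3) * (3072 * 663552 ^ 2 * c ^ 8 * e) ^ 4 *
        (32 * 663552 * c ^ 4 * e) := by gcongr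
    _ = (32 * 96 ^ 2 * 663552 * (3072 * 663552 ^ 2) ^ 4 * (32 * 663552)) * c ^ 41 * e ^ 7 := by ring
    _ ≤ (2 ^ 38) ^ 7 * c ^ 42 * e ^ 7 := by
        gcongr
        · norm_num
        · norm_num
    _ = _ := by ring

theorem le_spanner_card :
    e ≤ Fintype.card ((spanner c e hc he).Core ⊕ (spanner c e hc he).Mid) := by
  have hell : (spanner c e hc he).ell = 2 * e := rfl
  rw [card_vertices]
  generalize spanner c e hc he = P at *
  have hB : 0 < P.B := B_pos (by omega)
  have hk : 0 < 2 * P.D * P.m * (P.Q + 2 * P.Q * P.D) + P.m * P.R * P.mids := by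
    have := P.D_pos
    have := P.m_pos
    have := P.Q_pos
    positivity
  have hmR : 0 < 2 * P.m * P.R := Nat.mul_pos (Nat.mul_pos two_pos P.m_pos) P.R_pos
  calc e ≤ P.ell := by omega
    _ ≤ P.A := Nat.le_mul_of_pos_right _ hmR
    _ ≤ P.A * (4 * P.B * (2 * P.D * P.m * (P.Q + 2 * P.Q * P.D) + P.m * P.R * P.mids)) :=
        Nat.le_mul_of_pos_right _ (by positivity)
    _ = _ := by ring

end ObstacleParams

/-- Transfers a stretched pair in every sparse subgraph to an isomorphic graph on `Fin n`. -/
theorem SimpleGraph.exists_fin_of_stretched {V : Type*} [Fintype V] (G : SimpleGraph V) (b : ℝ)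
    (d : ℕ) (h : ∀ H ≤ G, (H.edgeSet.ncard : ℝ) ≤ b →
      ∃ (u v : V) (p : G.Walk u v), ∀ q : H.Walk u v, p.length + d ≤ q.length) :
    ∃ G' : SimpleGraph (Fin (Fintype.card V)), ∀ H' ≤ G', (H'.edgeSet.ncard : ℝ) ≤ b →
      ∃ u v, G'.Reachable u v ∧ (¬ H'.Reachable u v ∨ G'.dist u v + d ≤ H'.dist u v) := by
  let f := Fintype.equivFin V
  refine ⟨G.comap f.symm, fun H' hle hcard => ?_⟩
  let φ : H'.comap f ≃g H' := SimpleGraph.Iso.comap f H'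
  let ψ : G.comap f.symm ≃g G := SimpleGraph.Iso.comap f.symm G
  have hle' : H'.comap f ≤ G := by
    intro a b hab
    simpa using hle hab
  have hncard : (H'.comap f).edgeSet.ncard = H'.edgeSet.ncard :=
    Nat.card_congr φ.mapEdgeSet
  obtain ⟨u, v, p, hp⟩ := h _ hle' (by rwa [hncard])
  let p' : (G.comap f.symm).Walk (f u) (f v) := p.map ψ.symm.toHom
  have hp' : p'.length = p.length := SimpleGraph.Walk.length_map _ _
  refine ⟨f u, f v, p'.reachable, ?_⟩
  by_cases hr : H'.Reachable (f u) (f v)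
  · right
    obtain ⟨q, hq⟩ := hr.exists_walk_length_eq_dist
    let q' : (H'.comap f).Walk u v := (q.map φ.symm.toHom).copy (f.symm_apply_apply u)
      (f.symm_apply_apply v)
    have hq' : q'.length = q.length :=
      (SimpleGraph.Walk.length_copy _ _ _).trans (SimpleGraph.Walk.length_map _ _)
    have := hp q'
    have := SimpleGraph.dist_le p'
    omega
  · exact .inl hr

/-- There exist an absolute constant `ε > 0` and a threshold `C` such that for
every real `c₀ ≥ C` there are infinitely many positive integers `n` with the following
property: there is a simple graph `G` on `n` vertices such that every spanning subgraph `H`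
of `G` with at most `c₀·n` edges contains a pair of vertices `u, v` with `dist_G(u,v)`
finite (i.e. `u, v` reachable in `G`) and `dist_H(u,v) ≥ dist_G(u,v) + ε·n^{1/7}·c₀^{-80}`
(where `dist_H(u,v)` is infinite, i.e. the inequality holds vacuously, if `u, v` are not
reachable in `H`). -/
theorem additive_spanner_lower_bound :
    ∃ ε : ℝ, 0 < ε ∧ ∃ C : ℝ, ∀ c₀ : ℝ, C ≤ c₀ →
      ∀ N : ℕ, ∃ n : ℕ, N ≤ n ∧ 0 < n ∧
        ∃ G : SimpleGraph (Fin n),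
          ∀ H : SimpleGraph (Fin n), H ≤ G →
            (H.edgeSet.ncard : ℝ) ≤ c₀ * n →
            ∃ u v : Fin n, G.Reachable u v ∧
              (¬ H.Reachable u v ∨
                (G.dist u v : ℝ) + ε * (n : ℝ) ^ ((1 : ℝ) / 7) / c₀ ^ (80 : ℕ)
                  ≤ (H.dist u v : ℝ)) := by
  refine ⟨1 / 2 ^ 44, by positivity, 1, fun c₀ hc₀ N => ?_⟩
  have hc : 0 < ⌈c₀⌉₊ := Nat.ceil_pos.2 (by linarith)
  have he : 0 < N + 1 := N.succ_pos
  set P := ObstacleParams.spanner ⌈c₀⌉₊ (N + 1) hc he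
  set n := Fintype.card (P.Core ⊕ P.Mid)
  have hNn : N + 1 ≤ n := ObstacleParams.le_spanner_card hc he
  have hcard : n ≤ (2 ^ 38 * ⌈c₀⌉₊ ^ 6 * (N + 1)) ^ 7 := ObstacleParams.spanner_card_le hc he
  have hsparse : 8 * ⌈c₀⌉₊ * n ≤ 4 * (P.A * P.B * P.m * P.R * P.D) :=
    ObstacleParams.spanner_sparse hc he
  obtain ⟨G, hG⟩ := P.graph.exists_fin_of_stretched (c₀ * n) (N + 1) (by
    intro H hle hH
    refine ObstacleParams.exists_stretched_pair H hle he rfl ?_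
    have h₁ : (H.edgeSet.ncard : ℝ) ≤ ⌈c₀⌉₊ * n :=
      hH.trans (mul_le_mul_of_nonneg_right (Nat.le_ceil c₀) (Nat.cast_nonneg n))
    have h₂ : H.edgeSet.ncard ≤ ⌈c₀⌉₊ * n := by exact_mod_cast h₁
    nlinarith)
  refine ⟨n, by omega, by omega, G, fun H hle hH => ?_⟩
  obtain ⟨u, v, huv, h⟩ := hG H hle hH
  refine ⟨u, v, huv, h.imp_right fun h => ?_⟩
  have hd : (G.dist u v : ℝ) + (N + 1 : ℕ) ≤ H.dist u v := by exact_mod_cast h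
  refine le_trans (add_le_add_right ?_ _) hd
  have hceil : (⌈c₀⌉₊ : ℝ) ≤ 2 * c₀ := by
    have := Nat.ceil_lt_add_one (show 0 ≤ c₀ by linarith)
    linarith
  have hroot : (n : ℝ) ^ ((1 : ℝ) / 7) ≤ 2 ^ 38 * (⌈c₀⌉₊ : ℝ) ^ 6 * (N + 1 : ℕ) := by
    have h₁ : (n : ℝ) ≤ (2 ^ 38 * (⌈c₀⌉₊ : ℝ) ^ 6 * (N + 1 : ℕ)) ^ 7 := by exact_mod_cast hcard
    calc (n : ℝ) ^ ((1 : ℝ) / 7)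
        ≤ ((2 ^ 38 * (⌈c₀⌉₊ : ℝ) ^ 6 * (N + 1 : ℕ)) ^ 7) ^ ((1 : ℝ) / 7) :=
          Real.rpow_le_rpow (Nat.cast_nonneg n) h₁ (by norm_num)
      _ = _ := by
          rw [one_div]
          exact Real.pow_rpow_inv_natCast (by positivity) (by norm_num)
  have hpos : (0 : ℝ) < c₀ ^ 80 := by positivity
  rw [div_le_iff₀ hpos]
  calc 1 / 2 ^ 44 * (n : ℝ) ^ ((1 : ℝ) / 7)
      ≤ 1 / 2 ^ 44 * (2 ^ 38 * (⌈c₀⌉₊ : ℝ) ^ 6 * (N + 1 : ℕ)) := by gcongr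
    _ ≤ 1 / 2 ^ 44 * (2 ^ 38 * (2 * c₀) ^ 6 * (N + 1 : ℕ)) := by gcongr
    _ = (N + 1 : ℕ) * c₀ ^ 6 := by ring
    _ ≤ (N + 1 : ℕ) * c₀ ^ 80 := by gcongr; norm_num
end

section
/- There is a threshold C such that for every real c₀ ≥ C there exist reals ε₂ ≥ ε₁ > 0 (depending on c₀) with the following property: there are infinitely many positive integers n for which there exist a simple graph G on n vertices and a set P of ordered pairs of vertices of G with ε₁·n^{1/2} ≤ |P| ≤ ε₂·n^{1/2}, such that dist_G(s,t) is finite for every (s,t) ∈ P, and every spanning subgraph H of G with at most c₀·n edges contains a pair (s,t) ∈ P with dist_H(s,t) ≥ dist_G(s,t) + c₀. -/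
/-- The product `gen i₁ ^ s₁ * ⋯ * gen iₖ ^ sₖ` of a word whose last syllable is its head. -/
def wordProd {ι Γ : Type*} [Group Γ] (gen : ι → Γ) : List (ι × ℤ) → Γ
  | [] => 1
  | x :: l => wordProd gen l * gen x.1 ^ x.2

/-- Adjacent syllables of the word use different generators and no exponent vanishes. -/
def IsReducedWord {ι : Type*} (l : List (ι × ℤ)) : Prop :=
  l.IsChain (fun x y => x.1 ≠ y.1) ∧ ∀ x ∈ l, x.2 ≠ 0

/-- The number of letters of a word, each syllable being counted with multiplicity. -/
def wordLength {ι : Type*} (l : List (ι × ℤ)) : ℕ := (l.map fun x => x.2.natAbs).sum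

/-- No nonempty reduced word with at most `g` letters equals a power of a generator other than
the one in its last syllable. -/
def FreeUpTo {ι Γ : Type*} [Group Γ] (gen : ι → Γ) (g : ℕ) : Prop :=
  ∀ l : List (ι × ℤ), l ≠ [] → IsReducedWord l → wordLength l ≤ g →
    ∀ i, (∀ x ∈ l.head?, x.1 ≠ i) → ∀ j : ℤ, wordProd gen l ≠ gen i ^ j

lemma map_wordProd {ι Γ Γ' : Type*} [Group Γ] [Group Γ'] (f : Γ →* Γ') (gen : ι → Γ)
    (l : List (ι × ℤ)) : f (wordProd gen l) = wordProd (fun i => f (gen i)) l := by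
  induction l with
  | nil => simp [wordProd]
  | cons x l ih => simp [wordProd, ih]

/-- The permutation `u ↦ u + N u` for a square-zero endomorphism `N`. -/
def shear {U : Type*} [AddCommGroup U] (N : U →+ U) (hN : ∀ u, N (N u) = 0) :
    Equiv.Perm U where
  toFun u := u + N u
  invFun u := u - N u
  left_inv u := by simp [hN]
  right_inv u := by simp [hN]

lemma shear_zpow_apply {U : Type*} [AddCommGroup U] (N : U →+ U) (hN : ∀ u, N (N u) = 0)
    (s : ℤ) (u : U) : (shear N hN ^ s) u = u + s • N u := by
  induction s using Int.induction_on generalizing u with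
  | zero => simp
  | succ n ih =>
    rw [zpow_add_one, Equiv.Perm.mul_apply, ih]
    simp [shear, hN, add_smul]
    abel
  | pred n ih =>
    rw [zpow_sub_one, Equiv.Perm.mul_apply, ih]
    simp [shear, Equiv.Perm.inv_def, hN, sub_smul]
    abel

/-- The square-zero map sending coordinate `j - 1` to coordinate `j` whenever a maximal run
of entries equal to `i` in `ω` begins at position `j`. -/
def runShift {ι : Type*} [DecidableEq ι] (R p : ℕ) (ω : List ι) (i : ι) :
    (Fin (R + 1) → ZMod p) →+ (Fin (R + 1) → ZMod p) where
  toFun u j := if 0 < j.1 ∧ ω[j.1]? = some i ∧ ω[j.1 - 1]? ≠ some i then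
    u ⟨j.1 - 1, by omega⟩ else 0
  map_zero' := by ext j; simp
  map_add' u v := by ext j; simp only [Pi.add_apply]; split_ifs <;> simp

lemma runShift_runShift {ι : Type*} [DecidableEq ι] (R p : ℕ) (ω : List ι) (i : ι)
    (u : Fin (R + 1) → ZMod p) : runShift R p ω i (runShift R p ω i u) = 0 := by
  ext j
  simp only [runShift, AddMonoidHom.coe_mk, ZeroHom.coe_mk, Pi.zero_apply]
  split_ifs with h h' <;> first | rfl | exact absurd h'.2.1 h.2.2

/-- The permutation attached to the generator `i` by the pattern `ω`. -/
def runPerm {ι : Type*} [DecidableEq ι] (R p : ℕ) (ω : List ι) (i : ι) :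
    Equiv.Perm (Fin (R + 1) → ZMod p) :=
  shear (runShift R p ω i) (runShift_runShift R p ω i)

lemma runPerm_zpow_apply {ι : Type*} [DecidableEq ι] (R p : ℕ) (ω : List ι) (i : ι)
    (s : ℤ) (u : Fin (R + 1) → ZMod p) (j : Fin (R + 1)) :
    (runPerm R p ω i ^ s) u j =
      u j + s * (if 0 < j.1 ∧ ω[j.1]? = some i ∧ ω[j.1 - 1]? ≠ some i then
        u ⟨j.1 - 1, by omega⟩ else 0) := by
  rw [runPerm, shear_zpow_apply]
  simp [runShift]

lemma wordProd_runPerm_apply_ne_zero {ι : Type*} [DecidableEq ι] (R p : ℕ) [Fact p.Prime]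
    (ω : List ι) (l : List (ι × ℤ)) (t : ℕ) (ht : t + l.length ≤ R) (hl : IsReducedWord l)
    (hlp : ∀ x ∈ l, x.2.natAbs < p) (hω : ω.drop (t + 1) = l.map Prod.fst)
    (hhead : ∀ x ∈ l.head?, ω[t]? ≠ some x.1) (u : Fin (R + 1) → ZMod p)
    (hu : u ⟨t, by omega⟩ ≠ 0) (hu0 : ∀ j : Fin (R + 1), t < j.1 → u j = 0) :
    wordProd (runPerm R p ω) l u ⟨t + l.length, by omega⟩ ≠ 0 := by
  induction l generalizing t u with
  | nil => simpa [wordProd] using hu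
  | cons x l ih =>
    simp only [List.length_cons] at ht
    have hget : ω[t + 1]? = some x.1 := by
      have := congrArg (fun m => m[0]?) hω
      simpa using this
    have hdrop : ω.drop (t + 1 + 1) = l.map Prod.fst := by
      have := congrArg (fun m => m.drop 1) hω
      simpa [List.drop_drop] using this
    have key := ih (t + 1) (by omega) ⟨hl.1.tail, fun y hy => hl.2 y (by simp [hy])⟩
      (fun y hy => hlp y (by simp [hy])) hdrop ?_ ((runPerm R p ω x.1 ^ x.2) u) ?_ ?_
    · simp only [wordProd, Equiv.Perm.mul_apply]
      convert key using 3
      simp only [List.length_cons]; omega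
    · intro y hy
      rw [hget]
      cases l with
      | nil => simp at hy
      | cons z l =>
        have := hl.1
        rw [List.isChain_cons_cons] at this
        simp only [List.head?_cons, Option.mem_some_iff] at hy
        subst hy
        simpa using this.1
    · rw [runPerm_zpow_apply, hu0 _ (by simp), if_pos]
      · simp only [zero_add, Nat.add_sub_cancel]
        refine mul_ne_zero ?_ hu
        rw [Ne, ZMod.intCast_zmod_eq_zero_iff_dvd]
        intro hdvd
        have h1 := hlp x (by simp)
        have h2 := hl.2 x (by simp)
        exact h2 (Int.eq_zero_of_dvd_of_natAbs_lt_natAbs hdvd (by simpa using h1))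
      · exact ⟨by simp, hget, by simpa using hhead x (by simp)⟩
    · intro j hj
      rw [runPerm_zpow_apply, hu0 _ (by omega)]
      split_ifs with h
      · rw [hu0 _ (by simp only; omega)]; simp
      · simp

lemma length_le_wordLength {ι : Type*} {l : List (ι × ℤ)} (hl : ∀ x ∈ l, x.2 ≠ 0) :
    l.length ≤ wordLength l := by
  induction l with
  | nil => simp
  | cons x l ih =>
    have h1 := ih fun y hy => hl y (by simp [hy])
    have h2 := hl x (by simp)
    simp only [wordLength, List.map_cons, List.sum_cons, List.length_cons] at h1 ⊢
    omega

lemma natAbs_le_wordLength {ι : Type*} {l : List (ι × ℤ)} {x : ι × ℤ} (hx : x ∈ l) :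
    x.2.natAbs ≤ wordLength l :=
  List.single_le_sum (by simp) _ (List.mem_map.2 ⟨x, hx, rfl⟩)

/-- Some finite group contains a family of elements that is free up to length `g`. -/
theorem exists_finite_group_freeUpTo (ι : Type) [Finite ι] (g : ℕ) :
    ∃ (Γ : Type) (_ : Group Γ) (_ : Finite Γ) (gen : ι → Γ), FreeUpTo gen g := by
  classical
  obtain ⟨p, hgp, hp⟩ := Nat.exists_infinite_primes (g + 1)
  have : Fact p.Prime := ⟨hp⟩
  have : Finite {ω : List ι // ω.length ≤ g + 1} := List.finite_length_le ι (g + 1)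
  refine ⟨∀ _ : {ω : List ι // ω.length ≤ g + 1}, Equiv.Perm (Fin (g + 1) → ZMod p),
    inferInstance, inferInstance, fun i ω => runPerm g p ω.1 i, ?_⟩
  intro l hne hl hlen i hi j heq
  have hlg : l.length ≤ g := (length_le_wordLength hl.2).trans hlen
  let ω : {ω : List ι // ω.length ≤ g + 1} := ⟨i :: l.map Prod.fst, by simpa using hlg⟩
  let u : Fin (g + 1) → ZMod p := fun k => if k.1 = 0 then 1 else 0
  have h1 := congrArg (Pi.evalMonoidHom _ ω) heq
  rw [map_wordProd, map_zpow] at h1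
  have h2 := wordProd_runPerm_apply_ne_zero g p ω.1 l 0 (by omega) hl
    (fun x hx => by have := natAbs_le_wordLength hx; omega) (by simp [ω])
    (fun x hx => by simpa [ω] using (hi x hx).symm) u (by simp [u])
    (fun k hk => if_neg (Nat.ne_of_gt hk))
  refine h2 ?_
  have h3 := congrArg (fun e => e u ⟨0 + l.length, by omega⟩) h1
  simp only [Pi.evalMonoidHom_apply] at h3
  rw [h3, runPerm_zpow_apply]
  have hpos : 0 < l.length := List.length_pos_of_ne_nil hne
  have hu1 : u ⟨0 + l.length, by omega⟩ = 0 := if_neg (by simpa using hne)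
  rw [hu1]
  split_ifs with h
  · have : l.length ≠ 1 := by
      intro h1
      simp [ω, h1] at h
    simp only [u]
    rw [if_neg (by omega)]
    simp
  · simp

/-- The cycles of the Cayley graph of `gen` that are traversed by a single generator. -/
abbrev CycleLabel {ι Γ : Type*} [Group Γ] (gen : ι → Γ) : Type _ :=
  (i : ι) × Γ ⧸ Subgroup.zpowers (gen i)

/-- The `i`-cycle through `γ`. -/
def cycleLabel {ι Γ : Type*} [Group Γ] (gen : ι → Γ) (i : ι) (γ : Γ) : CycleLabel gen :=
  ⟨i, (γ : Γ ⧸ Subgroup.zpowers (gen i))⟩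

lemma cycleLabel_mul_zpow {ι Γ : Type*} [Group Γ] (gen : ι → Γ) (i : ι) (γ : Γ) (s : ℤ) :
    cycleLabel gen i (γ * gen i ^ s) = cycleLabel gen i γ := by
  simp only [cycleLabel, Sigma.mk.injEq, heq_eq_eq, true_and]
  exact (QuotientGroup.mk_mul_of_mem γ (Subgroup.zpow_mem_zpowers _ s))

lemma exists_zpow_of_cycleLabel_eq {ι Γ : Type*} [Group Γ] {gen : ι → Γ} {i : ι} {γ γ' : Γ}
    (h : cycleLabel gen i γ = cycleLabel gen i γ') : ∃ s : ℤ, γ⁻¹ * γ' = gen i ^ s := by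
  simp only [cycleLabel, Sigma.mk.injEq, heq_eq_eq, true_and] at h
  obtain ⟨s, hs⟩ := Subgroup.mem_zpowers_iff.1 (QuotientGroup.eq.1 h)
  exact ⟨s, hs.symm⟩

lemma eq_of_cycleLabel_eq {ι Γ : Type*} [Group Γ] {gen : ι → Γ} {i i' : ι} {γ γ' : Γ}
    (h : cycleLabel gen i γ = cycleLabel gen i' γ') : i = i' :=
  congrArg Sigma.fst h

section Cover

variable {ι Γ A : Type*} [Group Γ] [AddCommGroup A] {gen : ι → Γ} (δ : CycleLabel gen → A)

/-- Moving `s` steps along the `i`-line through `p`, in the cover of the Cayley graph of `gen`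
with voltages `δ`. -/
def move (i : ι) (s : ℤ) (p : A × Γ) : A × Γ :=
  (p.1 + s • δ (cycleLabel gen i p.2), p.2 * gen i ^ s)

lemma move_zero (i : ι) (p : A × Γ) : move δ i 0 p = p := by
  simp [move]

lemma move_move (i : ι) (s t : ℤ) (p : A × Γ) :
    move δ i t (move δ i s p) = move δ i (s + t) p := by
  simp [move, cycleLabel_mul_zpow, add_smul, zpow_add, add_assoc, mul_assoc]

lemma cycleLabel_move (i : ι) (s : ℤ) (p : A × Γ) :
    cycleLabel gen i (move δ i s p).2 = cycleLabel gen i p.2 :=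
  cycleLabel_mul_zpow gen i p.2 s

/-- The endpoint of the path that starts at `q` and follows a word from its last entry to its
head. -/
def runWord (q : A × Γ) : List (ι × ℤ) → A × Γ
  | [] => q
  | x :: l => move δ x.1 x.2 (runWord q l)

/-- The path that starts at `q` and follows a word never uses the cycle `C`. -/
def Avoids (C : CycleLabel gen) (q : A × Γ) : List (ι × ℤ) → Prop
  | [] => True
  | x :: l => cycleLabel gen x.1 (runWord δ q l).2 ≠ C ∧ Avoids C q l

lemma runWord_snd (q : A × Γ) (l : List (ι × ℤ)) :
    (runWord δ q l).2 = q.2 * wordProd gen l := by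
  induction l with
  | nil => simp [runWord, wordProd]
  | cons x l ih => simp [runWord, wordProd, move, ih, mul_assoc]

lemma exists_push {C : CycleLabel gen} {q : A × Γ} {l : List (ι × ℤ)} (hl : IsReducedWord l)
    (hC : Avoids δ C q l) (i : ι) {ε : ℤ} (hε : ε.natAbs = 1)
    (hi : cycleLabel gen i (runWord δ q l).2 ≠ C) :
    ∃ l', IsReducedWord l' ∧ Avoids δ C q l' ∧ wordLength l' ≤ wordLength l + 1 ∧
      runWord δ q l' = move δ i ε (runWord δ q l) := by
  cases l with
  | nil =>
    refine ⟨[(i, ε)], ⟨by simp, ?_⟩, ⟨hi, trivial⟩, by simp [wordLength, hε], rfl⟩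
    simp only [List.mem_singleton, forall_eq]
    omega
  | cons x l =>
    by_cases hx : x.1 = i
    · have hrun : move δ i ε (runWord δ q (x :: l)) = move δ i (x.2 + ε) (runWord δ q l) := by
        simp only [runWord, hx]
        exact move_move ..
      by_cases h0 : x.2 + ε = 0
      · refine ⟨l, ⟨hl.1.tail, fun y hy => hl.2 y (by simp [hy])⟩, hC.2, ?_, ?_⟩
        · simp only [wordLength, List.map_cons, List.sum_cons]; omega
        · rw [hrun, h0, move_zero]
      · refine ⟨(i, x.2 + ε) :: l, ⟨?_, ?_⟩, ⟨?_, hC.2⟩, ?_, ?_⟩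
        · cases l with
          | nil => simp
          | cons y l =>
            have := hl.1
            rw [List.isChain_cons_cons] at this ⊢
            exact ⟨by simpa [hx] using this.1, this.2⟩
        · intro y hy
          rcases List.mem_cons.1 hy with rfl | hy
          · exact h0
          · exact hl.2 y (by simp [hy])
        · simpa [hx] using hC.1
        · simp only [wordLength, List.map_cons, List.sum_cons]; omega
        · rw [hrun]; rfl
    · refine ⟨(i, ε) :: x :: l, ⟨?_, ?_⟩, ⟨hi, hC⟩, ?_, rfl⟩
      · rw [List.isChain_cons_cons]
        exact ⟨fun h => hx h.symm, hl.1⟩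
      · intro y hy
        rcases List.mem_cons.1 hy with rfl | hy
        · simp only; omega
        · exact hl.2 y hy
      · simp only [wordLength, List.map_cons, List.sum_cons]; omega

lemma eq_nil_of_avoids {g : ℕ} (hfree : FreeUpTo gen g) {i : ι} {q : A × Γ}
    {l : List (ι × ℤ)} (hl : IsReducedWord l) (hlen : wordLength l ≤ g)
    (hC : Avoids δ (cycleLabel gen i q.2) q l)
    (hend : cycleLabel gen i (runWord δ q l).2 = cycleLabel gen i q.2) : l = [] := by
  cases l with
  | nil => rfl
  | cons x l =>
    exfalso
    by_cases hx : x.1 = i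
    · refine hC.1 ?_
      rw [hx, ← hend]
      simp only [runWord, hx]
      rw [cycleLabel_move]
    · obtain ⟨j, hj⟩ := exists_zpow_of_cycleLabel_eq hend.symm
      rw [runWord_snd, inv_mul_cancel_left] at hj
      exact hfree _ (by simp) hl hlen i (by simpa using hx) j hj

/-- A walk of length at most `L + g` joining two points at distance `L` on a line of the cover
uses every edge of that line between them. -/
lemma line_edge_of_short_walk [Fintype (CycleLabel gen)] {g L : ℕ} (hfree : FreeUpTo gen g)
    (hrigid : ∀ (C : CycleLabel gen) (a : CycleLabel gen → ℤ),
      ∑ c, a c • δ c = (L : ℤ) • δ C → ∑ c, (a c).natAbs ≤ L + g → a C = L)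
    (htors : ∀ (C : CycleLabel gen) (k : ℤ), k • δ C = 0 → k = 0)
    {V : Type*} (φ : V → A × Γ) (H : SimpleGraph V)
    (hH : ∀ u v, H.Adj u v → ∃ i, φ u = move δ i 1 (φ v) ∨ φ u = move δ i (-1) (φ v))
    (i : ι) {s t : V} (hst : φ t = move δ i L (φ s)) (w : H.Walk t s)
    (hw : w.length ≤ L + g) (j : ℕ) (hj : j < L) :
    ∃ u v, H.Adj u v ∧ φ u = move δ i (j + 1) (φ s) ∧ φ v = move δ i j (φ s) := by
  classical
  by_contra! hno
  have inv : ∀ {u s : V} (w : H.Walk u s),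
      (∀ u v, H.Adj u v → φ u = move δ i (j + 1) (φ s) → φ v ≠ move δ i j (φ s)) →
      ∃ (a : CycleLabel gen → ℤ) (N : ℕ), (φ u).1 = (φ s).1 + ∑ c, a c • δ c ∧
        N + (a (cycleLabel gen i (φ s).2)).natAbs ≤ w.length ∧
        ∑ c ∈ Finset.univ.erase (cycleLabel gen i (φ s).2), (a c).natAbs ≤ N ∧
        (N ≤ g → ∃ k : ℤ, k ≤ j ∧ ∃ l, IsReducedWord l ∧
          Avoids δ (cycleLabel gen i (φ s).2) (move δ i k (φ s)) l ∧ wordLength l ≤ N ∧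
          φ u = runWord δ (move δ i k (φ s)) l) := by
    intro u s w hno
    induction w with
    | nil =>
      refine ⟨0, 0, by simp, by simp, by simp, fun _ => ⟨0, by simp, [], ⟨by simp, by simp⟩,
        trivial, by simp [wordLength], by simp [runWord, move_zero]⟩⟩
    | @cons u v s huv w ih =>
      obtain ⟨a, N, h1, h2, h3, h4⟩ := ih hno
      obtain ⟨i', ε, hε, hu⟩ : ∃ (i' : ι) (ε : ℤ), ε.natAbs = 1 ∧ φ u = move δ i' ε (φ v) := by
        obtain ⟨i', h | h⟩ := hH u v huv
        · exact ⟨i', 1, rfl, h⟩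
        · exact ⟨i', -1, rfl, h⟩
      set C := cycleLabel gen i (φ s).2 with hCdef
      set c := cycleLabel gen i' (φ v).2 with hcdef
      have hsum : (φ u).1 = (φ s).1 + ∑ d, (a + Pi.single c ε : CycleLabel gen → ℤ) d • δ d := by
        rw [hu]
        simp only [move, h1, Pi.add_apply, add_smul, Finset.sum_add_distrib, add_assoc]
        congr 2
        rw [Finset.sum_eq_single c]
        · simp [hcdef]
        · intro d _ hd; simp [hd]
        · simp
      by_cases hcC : c = C
      · refine ⟨a + Pi.single c ε, N, hsum, ?_, ?_, ?_⟩
        · simp only [hcC, Pi.add_apply, Pi.single_eq_same, SimpleGraph.Walk.length_cons]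
          clear h4
          omega
        · refine le_of_eq_of_le (Finset.sum_congr rfl fun d hd => ?_) h3
          rw [hcC]; simp [Finset.ne_of_mem_erase hd]
        · intro hN
          obtain ⟨k, hk, l, hl, hlC, hlN, hlv⟩ := h4 hN
          have hi : i' = i := eq_of_cycleLabel_eq hcC
          subst hi
          have hCk : C = cycleLabel gen i' (move δ i' k (φ s)).2 := by rw [cycleLabel_move]
          have hnil : l = [] := eq_nil_of_avoids δ hfree hl (hlN.trans hN) (hCk ▸ hlC)
            (by rw [← hlv, ← hCk]; exact hcC)
          subst hnil
          simp only [runWord] at hlv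
          have hu' : φ u = move δ i' (k + ε) (φ s) := by rw [hu, hlv, move_move]
          refine ⟨k + ε, ?_, [], ⟨by simp, by simp⟩, trivial, by simp [wordLength], hu'⟩
          by_contra hlt
          have hkj : k = j := by omega
          have hε1 : ε = 1 := by omega
          subst hε1
          rw [hkj] at hu' hlv
          exact hno u v huv hu' hlv
      · refine ⟨a + Pi.single c ε, N + 1, hsum, ?_, ?_, ?_⟩
        · have : C ≠ c := fun h => hcC h.symm
          simp only [Pi.add_apply, Pi.single_eq_of_ne this, add_zero,
            SimpleGraph.Walk.length_cons]
          clear h4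
          omega
        · have hmem : c ∈ Finset.univ.erase C := by simp [hcC]
          rw [← Finset.add_sum_erase _ _ hmem] at h3 ⊢
          have : ∑ d ∈ (Finset.univ.erase C).erase c,
              ((a + Pi.single c ε : CycleLabel gen → ℤ) d).natAbs =
              ∑ d ∈ (Finset.univ.erase C).erase c, (a d).natAbs :=
            Finset.sum_congr rfl fun d hd => by simp [Finset.ne_of_mem_erase hd]
          rw [this]
          simp only [Pi.add_apply, Pi.single_eq_same]
          clear h4
          omega
        · intro hN
          obtain ⟨k, hk, l, hl, hlC, hlN, hlv⟩ := h4 (by omega)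
          obtain ⟨l', hl', hlC', hlN', hlv'⟩ := exists_push δ hl hlC i' hε (by
            rw [← hlv]; exact hcC)
          exact ⟨k, hk, l', hl', hlC', by omega, by rw [hu, hlv', hlv]⟩
  obtain ⟨a, N, h1, h2, h3, h4⟩ := inv w hno
  have ha : a (cycleLabel gen i (φ s).2) = L := by
    refine hrigid _ a ?_ ?_
    · rw [hst] at h1
      exact (add_left_cancel h1).symm
    · rw [← Finset.add_sum_erase _ _ (Finset.mem_univ (cycleLabel gen i (φ s).2))]
      omega
  obtain ⟨k, hk, l, hl, hlC, hlN, hlv⟩ := h4 (by omega)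
  have hCk : cycleLabel gen i (φ s).2 = cycleLabel gen i (move δ i k (φ s)).2 := by
    rw [cycleLabel_move]
  have hnil : l = [] := eq_nil_of_avoids δ hfree hl (by omega) (hCk ▸ hlC)
    (by rw [← hlv, ← hCk, hst, cycleLabel_move])
  subst hnil
  simp only [runWord, hst, move, Prod.mk.injEq, add_right_inj] at hlv
  have := htors _ (L - k) (by rw [sub_smul, hlv.1, sub_self])
  omega

end Cover

/-- Voltages in strictly convex position, with an extra cyclic coordinate for each label. -/
def convexVoltage {ι : Type*} [DecidableEq ι] (idx : ι → ℕ) (m K : ℕ) (c : ι) :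
    ℤ × ℤ × (ι → ZMod K) :=
  (2 * m ^ 2 + 1 - idx c ^ 2, idx c, Pi.single c 1)

section ConvexVoltage

variable {ι : Type*} [DecidableEq ι] {idx : ι → ℕ} {m K : ℕ}

lemma convexVoltage_fst_bounds (hm : ∀ c, idx c ≤ m) (c : ι) :
    (m : ℤ) ^ 2 + 1 ≤ (convexVoltage idx m K c).1 ∧
      (convexVoltage idx m K c).1 ≤ 2 * ((m : ℤ) ^ 2 + 1) := by
  have h : (idx c : ℤ) ≤ m := by exact_mod_cast hm c
  simp only [convexVoltage]
  constructor <;> nlinarith [sq_nonneg (idx c : ℤ)]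

lemma eq_zero_of_zsmul_convexVoltage (hm : ∀ c, idx c ≤ m) (c : ι) (k : ℤ)
    (h : k • convexVoltage idx m K c = 0) : k = 0 := by
  have h1 := congrArg Prod.fst h
  have h2 := (convexVoltage_fst_bounds (K := K) hm c).1
  simp only [Prod.smul_fst, smul_eq_mul, Prod.fst_zero, mul_eq_zero] at h1
  rcases h1 with h1 | h1
  · exact h1
  · nlinarith [sq_nonneg (m : ℤ)]

/-- An integer combination of voltages equal to `L • convexVoltage idx m K C`, of total weight at
most `L + g`, has coefficient `L` at `C`. -/
lemma convexVoltage_rigid [Fintype ι] (hidx : idx.Injective) (hm : ∀ c, idx c ≤ m) {g : ℕ}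
    (hK : g * (3 * m ^ 2 + 1) < K) (L : ℕ) (C : ι) (a : ι → ℤ)
    (hsum : ∑ c, a c • convexVoltage idx m K c = (L : ℤ) • convexVoltage idx m K C)
    (hlen : ∑ c, (a c).natAbs ≤ L + g) : a C = L := by
  let f : ι → ℤ := fun c => 2 * m ^ 2 + 1 - idx c ^ 2 + 2 * idx C * idx c
  have hfsum : ∑ c, a c * f c = L * f C := by
    have h1 := congrArg Prod.fst hsum
    have h2 := congrArg (fun x => x.2.1) hsum
    simp only [Prod.fst_sum, Prod.snd_sum, Prod.smul_fst, Prod.smul_snd, convexVoltage,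
      smul_eq_mul] at h1 h2
    simp only [f, mul_add, Finset.sum_add_distrib]
    rw [h1]
    have : ∑ c, a c * (2 * (idx C : ℤ) * idx c) = 2 * idx C * ∑ c, a c * idx c := by
      rw [Finset.mul_sum]; exact Finset.sum_congr rfl fun c _ => by ring
    rw [this, h2]; ring
  have hmC : (idx C : ℤ) ≤ m := by exact_mod_cast hm C
  have hh : f C ≤ 3 * m ^ 2 + 1 := by simp only [f]; nlinarith
  have hh0 : 1 ≤ f C := by simp only [f]; nlinarith
  have hf : ∀ c, c ≠ C → 0 ≤ f c ∧ f c ≤ f C - 1 := by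
    intro c hc
    have hne : (idx c : ℤ) - idx C ≠ 0 := by
      rw [sub_ne_zero]; exact_mod_cast fun h => hc (hidx h)
    have hmc : (idx c : ℤ) ≤ m := by exact_mod_cast hm c
    have hpos : 0 < ((idx c : ℤ) - idx C) ^ 2 := by positivity
    simp only [f]
    constructor
    · have : (0 : ℤ) ≤ idx C * idx c := by positivity
      nlinarith
    · nlinarith
  set M : ℤ := ∑ c ∈ Finset.univ.erase C, |a c| with hM
  have hM0 : 0 ≤ M := Finset.sum_nonneg fun c _ => abs_nonneg _
  have hrest : ∑ c ∈ Finset.univ.erase C, a c * f c ≤ M * (f C - 1) := by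
    rw [hM, Finset.sum_mul]
    refine Finset.sum_le_sum fun c hc => ?_
    obtain ⟨h0, h1⟩ := hf c (Finset.ne_of_mem_erase hc)
    calc a c * f c ≤ |a c| * f c := by gcongr; exact le_abs_self _
      _ ≤ |a c| * (f C - 1) := by gcongr
  have hlenM : |a C| + M ≤ L + g := by
    rw [hM, Finset.add_sum_erase _ (fun c => |a c|) (Finset.mem_univ C)]
    have : (∑ c, ((a c).natAbs : ℤ)) ≤ L + g := by exact_mod_cast hlen
    simpa only [Int.natCast_natAbs] using this
  rw [← Finset.add_sum_erase _ _ (Finset.mem_univ C)] at hfsum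
  have haC := le_abs_self (a C)
  have hLM : (L : ℤ) - a C ≤ M := by
    by_contra! hlt
    nlinarith
  have hMg : M ≤ g * f C := by nlinarith
  have hg0 : (0 : ℤ) ≤ g := Int.natCast_nonneg g
  have hgK : (g : ℤ) * f C < K := by
    have : (g : ℤ) * (3 * m ^ 2 + 1) < K := by exact_mod_cast hK
    nlinarith
  have hmod : (K : ℤ) ∣ a C - L := by
    have h := congrArg (fun x => x.2.2 C) hsum
    simp only [Prod.snd_sum, Prod.smul_snd, convexVoltage, Finset.sum_apply, Pi.smul_apply] at h
    rw [Finset.sum_eq_single C (fun c _ hc => by simp [hc.symm]) (by simp)] at h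
    simp only [Pi.single_eq_same, zsmul_eq_mul, mul_one] at h
    rw [← ZMod.intCast_zmod_eq_zero_iff_dvd, Int.cast_sub, h, sub_self]
  have hzero := Int.eq_zero_of_abs_lt_dvd hmod (by
    rw [abs_lt]; constructor <;> nlinarith)
  omega

end ConvexVoltage

section CoverGraph

variable {ι Γ A V : Type*} [Group Γ] [AddCommGroup A] {gen : ι → Γ} (δ : CycleLabel gen → A)

/-- The subgraph of the cover induced, through the injection `φ`, on the vertex set `V`. -/
def coverGraph (hδ : ∀ c, δ c ≠ 0) (φ : V → A × Γ) : SimpleGraph V where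
  Adj u v := ∃ i, φ u = move δ i 1 (φ v) ∨ φ u = move δ i (-1) (φ v)
  symm := by
    constructor
    rintro u v ⟨i, h | h⟩
    · exact ⟨i, Or.inr (by rw [h, move_move]; simp [move_zero])⟩
    · exact ⟨i, Or.inl (by rw [h, move_move]; simp [move_zero])⟩
  loopless := by
    constructor
    rintro u ⟨i, h | h⟩
    · exact hδ _ (by simpa [move] using congrArg Prod.fst h)
    · exact hδ _ (by simpa [move] using congrArg Prod.fst h)

lemma exists_walk_along_line {hδ : ∀ c, δ c ≠ 0} {φ : V → A × Γ} {i : ι} {p : A × Γ} {L : ℕ}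
    {x : ℕ → V} (hx : ∀ k ≤ L, φ (x k) = move δ i k p) :
    ∃ w : (coverGraph δ hδ φ).Walk (x 0) (x L), w.length = L := by
  induction L with
  | zero => exact ⟨.nil, rfl⟩
  | succ L ih =>
    obtain ⟨w, hw⟩ := ih fun k hk => hx k (by omega)
    have hadj : (coverGraph δ hδ φ).Adj (x L) (x (L + 1)) :=
      ⟨i, Or.inr (by rw [hx L (by omega), hx (L + 1) le_rfl, move_move]; simp)⟩
    exact ⟨w.concat hadj, by simp [hw]⟩

end CoverGraph

lemma move_injective {ι Γ A : Type*} [Group Γ] [AddCommGroup A] {gen : ι → Γ}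
    (δ : CycleLabel gen → A) (i : ι) (s : ℤ) : Function.Injective (move (A := A) δ i s) := by
  intro p q h
  have := congrArg (move δ i (-s)) h
  simpa [move_move, move_zero] using this

lemma eq_of_add_mul_eq {q a s s' k k' : ℤ} (hs : 0 ≤ s) (hs' : 0 ≤ s') (hq : s < q)
    (hq' : s' < q) (ha : q ≤ a) (h : s + k * a = s' + k' * a) : k = k' := by
  rcases lt_trichotomy k k' with hlt | heq | hlt
  · nlinarith
  · exact heq
  · nlinarith

/-- A graph with at least `D / 8` times as many edges as vertices in which every additive
`g`-spanner of suitably chosen pairs contains `L` edges for each pair. -/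
theorem exists_graph_spanner_edges (g D : ℕ) :
    ∃ q W : ℕ, 0 < q ∧ 0 < W ∧ ∀ L : ℕ, 0 < L →
      ∃ (G : SimpleGraph (Fin (2 * (2 * q * (L + 1)) ^ 2 * W)))
        (P : Finset (Fin (2 * (2 * q * (L + 1)) ^ 2 * W) × Fin (2 * (2 * q * (L + 1)) ^ 2 * W))),
        P.card = q * (2 * q * (L + 1)) * W * D ∧ (∀ p ∈ P, G.Reachable p.1 p.2) ∧
        ∀ H ≤ G, (∀ p ∈ P, H.Reachable p.1 p.2 ∧ H.dist p.1 p.2 ≤ G.dist p.1 p.2 + g) →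
          q * (2 * q * (L + 1)) * W * D * L ≤ H.edgeSet.ncard := by
  classical
  obtain ⟨Γ, _, _, gen, hfree⟩ := exists_finite_group_freeUpTo (Fin D) g
  have : Fintype Γ := Fintype.ofFinite Γ
  have : Fintype (CycleLabel gen) := Fintype.ofFinite _
  let m := Fintype.card (CycleLabel gen)
  let idx : CycleLabel gen → ℕ := fun c => Fintype.equivFin _ c
  have hidx : idx.Injective := fun c c' h => (Fintype.equivFin _).injective (Fin.ext h)
  have hm : ∀ c, idx c ≤ m := fun c => (Fintype.equivFin _ c).2.le
  let K := g * (3 * m ^ 2 + 1) + 1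
  have : NeZero K := ⟨Nat.succ_ne_zero _⟩
  let q := m ^ 2 + 1
  let F := Γ × (CycleLabel gen → ZMod K)
  let δ := convexVoltage idx m K
  have htors : ∀ (C : CycleLabel gen) (k : ℤ), k • δ C = 0 → k = 0 :=
    fun C k h => eq_zero_of_zsmul_convexVoltage hm C k h
  have hδ : ∀ C, δ C ≠ 0 := fun C h => one_ne_zero (htors C 1 (by rw [h, smul_zero]))
  refine ⟨q, Fintype.card F, Nat.succ_pos _, Fintype.card_pos, fun L hL => ?_⟩
  set S := 2 * q * (L + 1) with hS
  let T := Fin S × Fin (2 * S) × F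
  have hT : Fintype.card T = 2 * S ^ 2 * Fintype.card F := by
    simp only [T, Fintype.card_prod, Fintype.card_fin]; ring
  let e : Fin (2 * S ^ 2 * Fintype.card F) ≃ T := (Fintype.equivFinOfCardEq hT).symm
  let φ : Fin (2 * S ^ 2 * Fintype.card F) → (ℤ × ℤ × (CycleLabel gen → ZMod K)) × Γ :=
    fun v => (((e v).1.1, (e v).2.1.1, (e v).2.2.2), (e v).2.2.1)
  have hφ : φ.Injective := by
    intro u v h
    simp only [φ, Prod.mk.injEq, Nat.cast_inj] at h
    exact e.injective (Prod.ext (Fin.ext h.1.1)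
      (Prod.ext (Fin.ext h.1.2.1) (Prod.ext h.2 h.1.2.2)))
  have hφbox : ∀ p : (ℤ × ℤ × (CycleLabel gen → ZMod K)) × Γ, 0 ≤ p.1.1 → p.1.1 < S →
      0 ≤ p.1.2.1 → p.1.2.1 < 2 * S → ∃ v, φ v = p := by
    rintro ⟨⟨a, b, κ⟩, γ⟩ ha ha' hb hb'
    simp only at ha ha' hb hb'
    refine ⟨e.symm (⟨a.toNat, by omega⟩, ⟨b.toNat, by omega⟩, γ, κ), ?_⟩
    simp only [φ, Equiv.apply_symm_apply, Prod.mk.injEq, and_true]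
    omega
  let start : Fin q × Fin S × F × Fin D → (ℤ × ℤ × (CycleLabel gen → ZMod K)) × Γ :=
    fun σ => ((σ.1.1, σ.2.1.1, σ.2.2.1.2), σ.2.2.1.1)
  have hstart : ∀ σ σ', start σ = start σ' → σ.2.2.2 = σ'.2.2.2 → σ = σ' := by
    rintro ⟨a, b, ⟨γ, κ⟩, i⟩ ⟨a', b', ⟨γ', κ'⟩, i'⟩ h hi
    simp only [start, Prod.mk.injEq, Nat.cast_inj] at h hi
    simp only [Prod.mk.injEq]
    exact ⟨Fin.ext h.1.1, Fin.ext h.1.2.1, Prod.ext h.2 h.1.2.2, hi⟩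
  have hvert : ∀ (σ : Fin q × Fin S × F × Fin D) (k : ℕ), ∃ v, k ≤ L →
      φ v = move δ σ.2.2.2 k (start σ) := by
    intro σ k
    by_cases hk : k ≤ L
    · have hbound := convexVoltage_fst_bounds (K := K) hm (cycleLabel gen σ.2.2.2 (start σ).2)
      have h2 : (idx (cycleLabel gen σ.2.2.2 (start σ).2) : ℤ) ≤ m := by exact_mod_cast hm _
      have hk' : (k : ℤ) ≤ L := by exact_mod_cast hk
      have h0 : (σ.1.1 : ℤ) < q := by exact_mod_cast σ.1.2
      have h1 : (σ.2.1.1 : ℤ) < S := by exact_mod_cast σ.2.1.2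
      have hSz : (S : ℤ) = 2 * q * (L + 1) := by rw [hS]; push_cast; ring
      have hqz : (q : ℤ) = m ^ 2 + 1 := by simp [q]
      have hk0 : (0 : ℤ) ≤ k := Int.natCast_nonneg k
      have hL0 : (0 : ℤ) ≤ L := Int.natCast_nonneg L
      have hmq : (m : ℤ) ≤ q := by nlinarith [sq_nonneg ((m : ℤ) - 1)]
      obtain ⟨v, hv⟩ := hφbox (move δ σ.2.2.2 k (start σ)) (by
          simp only [move, Prod.fst_add, Prod.smul_fst, smul_eq_mul]
          exact add_nonneg (by simp [start]) (mul_nonneg hk0 (by nlinarith))) (by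
          simp only [move, Prod.fst_add, Prod.smul_fst, smul_eq_mul]
          have : (k : ℤ) * (δ (cycleLabel gen σ.2.2.2 (start σ).2)).1 ≤ L * (2 * q) :=
            mul_le_mul hk' (by rw [hqz]; exact hbound.2) (by nlinarith) hL0
          simp only [start] at this ⊢
          nlinarith) (by
          simp only [move, Prod.fst_add, Prod.snd_add, Prod.smul_fst, Prod.smul_snd,
            smul_eq_mul]
          exact add_nonneg (by simp [start]) (mul_nonneg hk0 (by simp [δ, convexVoltage]))) (by
          simp only [move, Prod.fst_add, Prod.snd_add, Prod.smul_fst, Prod.smul_snd,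
            smul_eq_mul]
          have : (k : ℤ) * (δ (cycleLabel gen σ.2.2.2 (start σ).2)).2.1 ≤ L * m :=
            mul_le_mul hk' h2 (by simp [δ, convexVoltage]) hL0
          simp only [start] at this ⊢
          nlinarith)
      exact ⟨v, fun _ => hv⟩
    · exact ⟨e.symm (⟨0, by positivity⟩, ⟨0, by positivity⟩, 1, 0), fun h => absurd h hk⟩
  choose x hx using hvert
  have hcard : Fintype.card (Fin q × Fin S × F × Fin D) = q * S * Fintype.card F * D := by
    simp only [Fintype.card_prod, Fintype.card_fin]; ring
  have hlabel : ∀ {i i' : Fin D} {γ γ' : Γ} {k : ℕ}, 0 < k →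
      (k : ℤ) • δ (cycleLabel gen i γ) = (k : ℤ) • δ (cycleLabel gen i' γ') → i = i' := by
    intro i i' γ γ' k hk h
    have h1 := congrArg (fun y => y.2.1) h
    simp only [Prod.smul_fst, Prod.smul_snd, smul_eq_mul, δ, convexVoltage] at h1
    exact eq_of_cycleLabel_eq
      (hidx (by exact_mod_cast mul_left_cancel₀ (by exact_mod_cast hk.ne') h1))
  have hpair : Function.Injective fun σ => (x σ 0, x σ L) := by
    intro σ σ' h
    simp only [Prod.mk.injEq] at h
    have h0 : start σ = start σ' := by
      have := congrArg φ h.1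
      rwa [hx _ _ (Nat.zero_le _), hx _ _ (Nat.zero_le _), Nat.cast_zero, move_zero,
        move_zero] at this
    have h1 := congrArg (fun v => (φ v).1) h.2
    simp only [hx _ _ le_rfl, h0, move, add_right_inj] at h1
    exact hstart _ _ h0 (hlabel hL h1)
  have hx0 : ∀ σ, φ (x σ 0) = start σ := fun σ => by
    rw [hx _ _ (Nat.zero_le _), Nat.cast_zero, move_zero]
  refine ⟨coverGraph δ hδ φ, Finset.univ.image fun σ => (x σ 0, x σ L), ?_, ?_, ?_⟩
  · rw [Finset.card_image_of_injective _ hpair, Finset.card_univ, hcard]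
  · intro p hp
    obtain ⟨σ, -, rfl⟩ := Finset.mem_image.1 hp
    exact (exists_walk_along_line δ (hδ := hδ) (hx σ)).choose.reachable
  · intro H hHG hP
    have hedge : ∀ (σ : Fin q × Fin S × F × Fin D) (j : Fin L),
        s(x σ (j + 1), x σ j) ∈ H.edgeSet := by
      intro σ j
      obtain ⟨hreach, hdist⟩ := hP (x σ 0, x σ L) (Finset.mem_image_of_mem _ (Finset.mem_univ σ))
      dsimp only at hreach hdist
      obtain ⟨w, hw⟩ := hreach.exists_walk_length_eq_dist
      obtain ⟨w', hw'⟩ := exists_walk_along_line δ (hδ := hδ) (hx σ)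
      have hle := SimpleGraph.dist_le w'
      obtain ⟨u, v, huv, hu, hv⟩ := line_edge_of_short_walk δ hfree
        (fun C a => convexVoltage_rigid hidx hm (Nat.lt_succ_self _) L C a) htors φ H
        (fun u v h => hHG h) σ.2.2.2 (s := x σ 0) (t := x σ L) (by rw [hx _ _ le_rfl, hx0])
        w.reverse (by rw [SimpleGraph.Walk.length_reverse]; omega) j j.2
      have hu' : u = x σ (j + 1) := hφ (by rw [hu, hx0 σ, hx σ (j + 1) (by omega)]; push_cast; rfl)
      have hv' : v = x σ j := hφ (by rw [hv, hx0 σ, hx σ j (by omega)])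
      rw [← hu', ← hv']
      exact huv
    have hstep : ∀ (σ : Fin q × Fin S × F × Fin D) (j : Fin L),
        φ (x σ (j + 1)) = move δ σ.2.2.2 1 (φ (x σ j)) := by
      intro σ j
      rw [hx _ _ (by omega), hx _ _ (by omega), move_move]; push_cast; rfl
    have hlt : ∀ (σ : Fin q × Fin S × F × Fin D) (j : Fin L),
        (φ (x σ j)).1.1 < (φ (x σ (j + 1))).1.1 := by
      intro σ j
      rw [hstep]
      have := (convexVoltage_fst_bounds (K := K) hm
        (cycleLabel gen σ.2.2.2 (φ (x σ j)).2)).1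
      simp only [move, one_smul, Prod.fst_add]
      have h2 : (0 : ℤ) < m ^ 2 + 1 := by positivity
      simp only [δ]
      linarith
    have hinj : Function.Injective fun y : (Fin q × Fin S × F × Fin D) × Fin L =>
        s(x y.1 (y.2 + 1), x y.1 y.2) := by
      rintro ⟨σ, j⟩ ⟨σ', j'⟩ h
      rcases Sym2.eq_iff.1 h with ⟨h1, h0⟩ | ⟨h1, h0⟩
      · simp only at h1 h0
        have h2 := congrArg (fun v => (φ v).1) h1
        simp only [hstep, h0, move, add_right_inj] at h2
        have hi : σ.2.2.2 = σ'.2.2.2 := hlabel (k := 1) one_pos (by simpa using h2)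
        have h3 := congrArg φ h0
        rw [hx _ _ (by omega), hx _ _ (by omega), hi] at h3
        have hC : cycleLabel gen σ'.2.2.2 (start σ).2 = cycleLabel gen σ'.2.2.2 (start σ').2 := by
          rw [← cycleLabel_move δ σ'.2.2.2 j (start σ), h3, cycleLabel_move]
        have h4 := congrArg (fun p => p.1.1) h3
        simp only [move, Prod.fst_add, Prod.smul_fst, smul_eq_mul, hC] at h4
        have hj : (j : ℤ) = j' := eq_of_add_mul_eq (q := q) (by simp [start])
          (by simp [start]) (by simp [start]) (by simp [start])
          (by simpa [q] using (convexVoltage_fst_bounds (K := K) hm _).1) h4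
        rw [hj] at h3
        have hj' : j = j' := Fin.ext (by exact_mod_cast hj)
        rw [hstart _ _ (move_injective δ _ _ h3) hi, hj']
      · have h2 := hlt σ j
        have h3 := hlt σ' j'
        simp only at h1 h0
        rw [h1, h0] at h2
        exact absurd h2 h3.not_gt
    rw [← hcard]
    calc _ = (Set.range fun y : (Fin q × Fin S × F × Fin D) × Fin L =>
          s(x y.1 (y.2 + 1), x y.1 y.2)).ncard := by
          rw [← Set.image_univ, Set.ncard_image_of_injective _ hinj, Set.ncard_univ,
            Nat.card_eq_fintype_card]
          simp only [Fintype.card_prod, Fintype.card_fin]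
      _ ≤ _ := Set.ncard_le_ncard (by rintro _ ⟨y, rfl⟩; exact hedge y.1 y.2) (Set.toFinite _)

/-- There is a threshold `C` such that for every real `c₀ ≥ C` there exist
reals `ε₂ ≥ ε₁ > 0` (depending on `c₀`) with the following property: there are infinitely
many positive integers `n` for which there exist a simple graph `G` on `n` vertices and a
set `P` of ordered pairs of vertices of `G` with `ε₁·n^{1/2} ≤ |P| ≤ ε₂·n^{1/2}`, such
that `dist_G(s,t)` is finite for every `(s,t) ∈ P`, and every spanning subgraph `H` of `G`
with at most `c₀·n` edges contains a pair `(s,t) ∈ P` with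
`dist_H(s,t) ≥ dist_G(s,t) + c₀` (the inequality holding vacuously when `s, t` are not
reachable in `H`, i.e. `dist_H(s,t)` is infinite). -/
theorem pairwise_spanner_lower_bound :
    ∃ C : ℝ, ∀ c₀ : ℝ, C ≤ c₀ →
      ∃ ε₁ ε₂ : ℝ, 0 < ε₁ ∧ ε₁ ≤ ε₂ ∧
        ∀ N : ℕ, ∃ n : ℕ, N ≤ n ∧ 0 < n ∧
          ∃ (G : SimpleGraph (Fin n)) (P : Finset (Fin n × Fin n)),
            ε₁ * Real.sqrt n ≤ (P.card : ℝ) ∧ (P.card : ℝ) ≤ ε₂ * Real.sqrt n ∧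
            (∀ p ∈ P, G.Reachable p.1 p.2) ∧
            ∀ H : SimpleGraph (Fin n), H ≤ G →
              (H.edgeSet.ncard : ℝ) ≤ c₀ * n →
              ∃ p ∈ P, (¬ H.Reachable p.1 p.2 ∨
                (G.dist p.1 p.2 : ℝ) + c₀ ≤ (H.dist p.1 p.2 : ℝ)) := by
  refine ⟨0, fun c₀ hc₀ => ?_⟩
  obtain ⟨D, hD⟩ := exists_nat_gt (8 * c₀)
  have hD0 : (0 : ℝ) < D := by linarith
  obtain ⟨q, W, hq, hW, hgraph⟩ := exists_graph_spanner_edges ⌈c₀⌉₊ D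
  have hq' : (0 : ℝ) < q := by exact_mod_cast hq
  have hW' : (0 : ℝ) < W := by exact_mod_cast hW
  refine ⟨q * W * D / √(2 * W), q * W * D / √(2 * W), by positivity, le_rfl, fun N => ?_⟩
  obtain ⟨G, P, hcard, hreach, hspan⟩ := hgraph (N + 1) N.succ_pos
  have hn : 0 < 2 * (2 * q * (N + 1 + 1)) ^ 2 * W := by positivity
  have hsqrt : q * W * D / √(2 * W) * √((2 * (2 * q * (N + 1 + 1)) ^ 2 * W : ℕ) : ℝ) =
      (P.card : ℝ) := by
    have h1 : ((2 * (2 * q * (N + 1 + 1)) ^ 2 * W : ℕ) : ℝ) =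
        (2 * q * (N + 1 + 1) : ℝ) ^ 2 * (2 * W) := by push_cast; ring
    have h2 : √(2 * W : ℝ) ≠ 0 := by positivity
    rw [h1, Real.sqrt_mul (sq_nonneg _) (2 * W), Real.sqrt_sq (by positivity), hcard]
    push_cast
    field_simp
  refine ⟨_, ?_, hn, G, P, hsqrt.le, hsqrt.ge, hreach, fun H hHG hH => ?_⟩
  · calc N ≤ 2 * q * (N + 1 + 1) := by nlinarith
      _ ≤ (2 * q * (N + 1 + 1)) ^ 2 := Nat.le_self_pow two_ne_zero _
      _ ≤ 2 * (2 * q * (N + 1 + 1)) ^ 2 * W := by nlinarith [sq_nonneg (2 * q * (N + 1 + 1))]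
  · by_contra! hall
    have hle := hspan H hHG fun p hp => ⟨(hall p hp).1, by
      have h1 := (hall p hp).2
      have h2 := Nat.le_ceil c₀
      have h3 : (H.dist p.1 p.2 : ℝ) ≤ (G.dist p.1 p.2 + ⌈c₀⌉₊ : ℕ) := by push_cast; linarith
      exact_mod_cast h3⟩
    have hle' : ((q * (2 * q * (N + 1 + 1)) * W * D * (N + 1) : ℕ) : ℝ) ≤
        c₀ * (2 * (2 * q * (N + 1 + 1)) ^ 2 * W : ℕ) := (Nat.cast_le.2 hle).trans hH
    push_cast at hle'
    have hN : (0 : ℝ) ≤ N := N.cast_nonneg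
    have hlt : 4 * c₀ * (N + 1 + 1) < D * (N + 1) := by nlinarith
    have hpos : (0 : ℝ) < q * (2 * q * (N + 1 + 1)) * W := by positivity
    have := mul_lt_mul_of_pos_left hlt hpos
    linarith
end

section
/- Let x, y, r be positive integers with 4r ≤ x, and let v = (v₁, v₂) ∈ ℤ² satisfy r/2 ≤ v₁, ‖v‖ ≤ r, 0 ≤ v₂ ≤ v₁, and 2x·v₂ ≤ y·v₁. Then for every s = (s₁, s₂) ∈ ℤ² with 1 ≤ s₁ ≤ r/2 and 1 ≤ s₂ ≤ y/2, there exists a positive integer k such that s + k·v ∈ {x−r,…,x}×{1,…,y}. -/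
/-- Let `x, y, r` be positive integers with `4r ≤ x`, and let
`v = (v₁, v₂) ∈ ℤ²` satisfy `r/2 ≤ v₁` (i.e. `r ≤ 2v₁`), `‖v‖ ≤ r` (Euclidean norm),
`0 ≤ v₂ ≤ v₁`, and `2x·v₂ ≤ y·v₁`. Then for every `s = (s₁, s₂) ∈ ℤ²` with
`1 ≤ s₁ ≤ r/2` and `1 ≤ s₂ ≤ y/2`, there exists a positive integer `k` such that
`s + k·v ∈ {x−r,…,x} × {1,…,y}`. -/
theorem critical_pair_target_exists
    (x y r : ℕ) (hx : 0 < x) (hy : 0 < y) (hr : 0 < r) (hrx : 4 * r ≤ x)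
    (v : ℤ × ℤ)
    (hv1 : (r : ℤ) ≤ 2 * v.1)
    (hvnorm : Real.sqrt ((v.1 : ℝ) ^ 2 + (v.2 : ℝ) ^ 2) ≤ (r : ℝ))
    (hv2 : 0 ≤ v.2) (hv21 : v.2 ≤ v.1)
    (hangle : 2 * (x : ℤ) * v.2 ≤ (y : ℤ) * v.1)
    (s : ℤ × ℤ)
    (hs1 : 1 ≤ s.1) (hs1' : 2 * s.1 ≤ (r : ℤ))
    (hs2 : 1 ≤ s.2) (hs2' : 2 * s.2 ≤ (y : ℤ)) :
    ∃ k : ℕ, 0 < k ∧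
      (x : ℤ) - (r : ℤ) ≤ (s + (k : ℤ) • v).1 ∧ (s + (k : ℤ) • v).1 ≤ (x : ℤ) ∧
      1 ≤ (s + (k : ℤ) • v).2 ∧ (s + (k : ℤ) • v).2 ≤ (y : ℤ) := by
  obtain ⟨a, b⟩ := v
  obtain ⟨p, q⟩ := s
  dsimp only at *
  have har : a ≤ (r : ℤ) := by
    have h : (a : ℝ) ≤ r := (Real.le_sqrt_of_sq_le (by nlinarith [sq_nonneg (b : ℝ)])).trans hvnorm
    exact_mod_cast h
  have ha : 0 < a := by omega
  have hdiv := Int.mul_ediv_add_emod ((x : ℤ) - p) a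
  have hmod_nonneg := Int.emod_nonneg ((x : ℤ) - p) ha.ne'
  have hmod_lt := Int.emod_lt_of_pos ((x : ℤ) - p) ha
  have hk : 0 < ((x : ℤ) - p) / a := Int.le_ediv_of_mul_le ha (by omega)
  obtain ⟨k, hk_eq⟩ := Int.eq_ofNat_of_zero_le hk.le
  rw [hk_eq] at hdiv hk
  have hslope : 2 * ((k : ℤ) * b) ≤ y := by
    have hka : (k : ℤ) * a ≤ x := by linarith
    have hx' : (0 : ℤ) < x := by exact_mod_cast hx
    refine le_of_mul_le_mul_left ?_ hx'
    calc (x : ℤ) * (2 * (k * b)) = k * (2 * x * b) := by ring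
      _ ≤ k * (y * a) := by gcongr
      _ = y * (k * a) := by ring
      _ ≤ y * x := by gcongr
      _ = x * y := by ring
  have hkb : 0 ≤ (k : ℤ) * b := by positivity
  refine ⟨k, by exact_mod_cast hk, ?_⟩
  simp only [Prod.smul_mk, Prod.mk_add_mk, smul_eq_mul]
  refine ⟨?_, ?_, ?_, ?_⟩ <;> linarith
end

section
/- Let x, y, r be positive integers with r even and 4r ≤ x, and let v = (v₁, v₂) ∈ ℤ² satisfy r/2 ≤ v₁ ≤ r, 0 ≤ v₂, 2x·v₂ ≤ y·v₁, and v₁ ∣ (x − r/2). Then for every s = (s₁, s₂) ∈ ℤ² with 1 ≤ s₁ ≤ r/2 and 1 ≤ s₂ ≤ y/2, the largest positive integer k with s + k·v ∈ {1,…,x}×{1,…,y} exists and satisfies k·v₁ = x − r/2; in particular, the first coordinate of s + k·v equals s₁ + x − r/2. -/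
/-- Let `x, y, r` be positive integers with `r` even and `4r ≤ x`, and let
`v = (v₁, v₂) ∈ ℤ²` satisfy `r/2 ≤ v₁ ≤ r`, `0 ≤ v₂`, `2x·v₂ ≤ y·v₁`, and
`v₁ ∣ (x − r/2)`. Then for every `s = (s₁, s₂) ∈ ℤ²` with `1 ≤ s₁ ≤ r/2` and
`1 ≤ s₂ ≤ y/2`, the largest positive integer `k` with `s + k·v ∈ {1,…,x} × {1,…,y}`
exists and satisfies `k·v₁ = x − r/2`; in particular the first coordinate of `s + k·v`
equals `s₁ + x − r/2`. -/
theorem horizontal_displacement_constant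
    (x y r : ℕ) (hx : 0 < x) (hy : 0 < y) (hr : 0 < r) (her : Even r) (hrx : 4 * r ≤ x)
    (v : ℤ × ℤ)
    (hv1 : (r : ℤ) ≤ 2 * v.1) (hv1' : v.1 ≤ (r : ℤ))
    (hv2 : 0 ≤ v.2)
    (hangle : 2 * (x : ℤ) * v.2 ≤ (y : ℤ) * v.1)
    (hdvd : v.1 ∣ ((x : ℤ) - (r : ℤ) / 2))
    (s : ℤ × ℤ)
    (hs1 : 1 ≤ s.1) (hs1' : 2 * s.1 ≤ (r : ℤ))
    (hs2 : 1 ≤ s.2) (hs2' : 2 * s.2 ≤ (y : ℤ)) :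
    ∃ k : ℕ, 0 < k ∧
      (1 ≤ (s + (k : ℤ) • v).1 ∧ (s + (k : ℤ) • v).1 ≤ (x : ℤ) ∧
        1 ≤ (s + (k : ℤ) • v).2 ∧ (s + (k : ℤ) • v).2 ≤ (y : ℤ)) ∧
      (∀ k' : ℕ, 0 < k' →
        (1 ≤ (s + (k' : ℤ) • v).1 ∧ (s + (k' : ℤ) • v).1 ≤ (x : ℤ) ∧
          1 ≤ (s + (k' : ℤ) • v).2 ∧ (s + (k' : ℤ) • v).2 ≤ (y : ℤ)) → k' ≤ k) ∧
      (k : ℤ) * v.1 = (x : ℤ) - (r : ℤ) / 2 ∧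
      (s + (k : ℤ) • v).1 = s.1 + (x : ℤ) - (r : ℤ) / 2 := by
  obtain ⟨m, rfl⟩ := her
  obtain ⟨a, b⟩ := v
  obtain ⟨p, q⟩ := s
  have hhalf : ((m + m : ℕ) : ℤ) / 2 = m := by omega
  rw [hhalf] at hdvd ⊢
  obtain ⟨c, hc⟩ := hdvd
  simp only [Prod.fst_add, Prod.snd_add, Prod.smul_fst, Prod.smul_snd, smul_eq_mul] at *
  push_cast at *
  have ha : 0 < a := by omega
  have hcpos : 0 < c := by
    refine pos_of_mul_pos_right (a := a) ?_ ha.le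
    omega
  lift c to ℕ using hcpos.le
  have hca : (c : ℤ) * a = x - m := by rw [hc, mul_comm]
  have hcb : 0 ≤ (c : ℤ) * b := by positivity
  have hcb' : 2 * ((c : ℤ) * b) ≤ y := by
    have hxpos : (0 : ℤ) < x := by exact_mod_cast hx
    refine le_of_mul_le_mul_left ?_ hxpos
    calc (x : ℤ) * (2 * (c * b)) = c * (2 * x * b) := by ring
      _ ≤ c * (y * a) := by gcongr
      _ = y * (x - m) := by rw [← hca]; ring
      _ ≤ y * x := by gcongr; omega
      _ = x * y := mul_comm _ _
  refine ⟨c, by exact_mod_cast hcpos, ⟨by omega, by omega, by omega, by omega⟩, ?_, hca, by omega⟩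
  rintro k - ⟨-, hk, -, -⟩
  by_contra! hlt
  have hmul : ((c : ℤ) + 1) * a ≤ k * a := by
    gcongr
    exact_mod_cast hlt
  rw [add_mul, one_mul] at hmul
  omega
end
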